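/- Suppose the C² cost function c satisfies conditions A1, A2, Ω and Ω* are c-convex with respect to each other, and c satisfies condition A3v. Then condition A3v holds without the error term: for all x₀, x ∈ Ω, y₀, y₁ ∈ Ω* and θ ∈ [0,1], with y_θ the point of the c-segment from y₀ to y₁ with respect to x₀, max{c(x₀,y₀) − c(x,y₀), c(x₀,y₁) − c(x,y₁)} ≥ c(x₀,y_θ) − c(x,y_θ). -/

import Mathlib

open Set Filter Topology MeasureTheory RealInnerProductSpace

noncomputable section

/-- Euclidean space ℝⁿ. -/
abbrev E (n : ℕ) := EuclideanSpace ℝ (Fin n)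

/-- Partial gradient of the cost in the `x` variable. -/
noncomputable def Dx {n : ℕ} (c : E n → E n → ℝ) (x y : E n) : E n :=
  gradient (fun x' => c x' y) x

/-- Partial gradient of the cost in the `y` variable. -/
noncomputable def Dy {n : ℕ} (c : E n → E n → ℝ) (x y : E n) : E n :=
  gradient (fun y' => c x y') y

/-- Mixed second derivative `D²_{xy} c (x,y)`, as the derivative in `y` of `x ↦ D_x c(x,y)`,
a continuous linear map acting on vectors of ℝⁿ. -/
noncomputable def Dxy {n : ℕ} (c : E n → E n → ℝ) (x y : E n) : E n →L[ℝ] E n :=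
  fderiv ℝ (fun y' => Dx c x y') y

/-- Quadratic form of the Hessian `D²_{xx} c(x,y)` evaluated at `ξ`. -/
noncomputable def DxxQ {n : ℕ} (c : E n → E n → ℝ) (x y ξ : E n) : ℝ :=
  ⟪(fderiv ℝ (fun x' => Dx c x' y) x) ξ, ξ⟫

/-- `Ω` is a bounded open connected domain. -/
def NiceDomain {n : ℕ} (Ω : Set (E n)) : Prop :=
  Bornology.IsBounded Ω ∧ IsOpen Ω ∧ IsConnected Ω

/-- The cost function is C² on an open neighbourhood of `Ω × Ω*`. -/
def CostC2 {n : ℕ} (Ω Ωs : Set (E n)) (c : E n → E n → ℝ) : Prop :=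
  ∃ U : Set (E n × E n), IsOpen U ∧ Ω ×ˢ Ωs ⊆ U ∧ ContDiffOn ℝ 2 (fun p => c p.1 p.2) U

/-- Condition A1: injectivity of `y ↦ -D_x c(x,y)` on `Ω*` and of `x ↦ -D_y c(x,y)` on `Ω`. -/
def CondA1 {n : ℕ} (Ω Ωs : Set (E n)) (c : E n → E n → ℝ) : Prop :=
  (∀ x ∈ Ω, Set.InjOn (fun y => -Dx c x y) Ωs) ∧
  (∀ y ∈ Ωs, Set.InjOn (fun x => -Dy c x y) Ω)

/-- Condition A2: invertibility of the mixed second derivative `D²_{xy} c`. -/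
def CondA2 {n : ℕ} (Ω Ωs : Set (E n)) (c : E n → E n → ℝ) : Prop :=
  ∀ x ∈ Ω, ∀ y ∈ Ωs, Function.Bijective (Dxy c x y)

/-- `Ω` and `Ω*` are c-convex with respect to each other. -/
def MutuallyCConvex {n : ℕ} (Ω Ωs : Set (E n)) (c : E n → E n → ℝ) : Prop :=
  (∀ x ∈ Ω, Convex ℝ ((fun y => -Dx c x y) '' Ωs)) ∧
  (∀ y ∈ Ωs, Convex ℝ ((fun x => -Dy c x y) '' Ω))

/-- Condition A3v: for every point `y_θ` of the c-segment from `y₀` to `y₁` with respect to `x₀`,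
`max{c(x₀,y₀) − c(x,y₀), c(x₀,y₁) − c(x,y₁)} ≥ c(x₀,y_θ) − c(x,y_θ) + o(|x−x₀|²)` as `x → x₀`. -/
def CondA3v {n : ℕ} (Ω Ωs : Set (E n)) (c : E n → E n → ℝ) : Prop :=
  ∀ x₀ ∈ Ω, ∀ y₀ ∈ Ωs, ∀ y₁ ∈ Ωs, ∀ θ ∈ Ioo (0:ℝ) 1, ∀ yθ ∈ Ωs,
    -Dx c x₀ yθ = (1 - θ) • (-Dx c x₀ y₀) + θ • (-Dx c x₀ y₁) →
    ∃ η : ℝ → ℝ, Tendsto η (𝓝[>] (0:ℝ)) (𝓝 0) ∧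
      ∀ x ∈ Ω, max (c x₀ y₀ - c x y₀) (c x₀ y₁ - c x y₁) ≥
        c x₀ yθ - c x yθ - η ‖x - x₀‖ * ‖x - x₀‖ ^ 2

/-- `φ` is (globally) c-convex on `Ω`: it admits a global c-support at every point. -/
def CConvex {n : ℕ} (Ω Ωs : Set (E n)) (c : E n → E n → ℝ) (φ : E n → ℝ) : Prop :=
  ∀ x₀ ∈ Ω, ∃ y₀ ∈ Ωs, ∃ l : ℝ, (∀ x ∈ Ω, φ x ≥ -l - c x y₀) ∧ φ x₀ = -l - c x₀ y₀

/-- The c-transform `φ^c(y) = sup_{x ∈ Ω} (−φ(x) − c(x,y))`. -/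
noncomputable def CTransform {n : ℕ} (Ω : Set (E n)) (c : E n → E n → ℝ) (φ : E n → ℝ)
    (y : E n) : ℝ :=
  sSup ((fun x => -φ x - c x y) '' Ω)


structure Dat {H : Type*} [NormedAddCommGroup H] [InnerProductSpace ℝ H] [FiniteDimensional ℝ H]
    (Ω Ωs : Set H) (c : H → H → ℝ) (P q : H → H → H) (A M : H → H → H →L[ℝ] H) : Prop where
  oΩ : IsOpen Ω
  oS : IsOpen Ωs
  cx : ∀ x ∈ Ω, ∀ y ∈ Ωs, HasFDerivAt (fun x => c x y) (-(innerSL ℝ (P x y))) x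
  cy : ∀ x ∈ Ω, ∀ y ∈ Ωs, HasFDerivAt (fun y => c x y) (-(innerSL ℝ (q x y))) y
  P' : ∀ x ∈ Ω, ∀ y ∈ Ωs,
    HasStrictFDerivAt (fun z : H × H => P z.1 z.2) ((A x y).coprod (M x y)) (x, y)
  q' : ∀ x ∈ Ω, ∀ y ∈ Ωs,
    HasStrictFDerivAt (fun x => q x y) (ContinuousLinearMap.adjoint (M x y)) x
  cA : ∀ x ∈ Ω, ∀ y ∈ Ωs, ContinuousAt (fun z : H × H => A z.1 z.2) (x, y)
  cM : ∀ x ∈ Ω, ∀ y ∈ Ωs, ContinuousAt (fun z : H × H => M z.1 z.2) (x, y)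
  bij : ∀ x ∈ Ω, ∀ y ∈ Ωs, Function.Bijective (M x y)
  injP : ∀ x ∈ Ω, Set.InjOn (P x) Ωs
  injq : ∀ y ∈ Ωs, Set.InjOn (fun x => q x y) Ω
  convP : ∀ x ∈ Ω, Convex ℝ (P x '' Ωs)
  convq : ∀ y ∈ Ωs, Convex ℝ ((fun x => q x y) '' Ω)
  a3v : ∀ x₀ ∈ Ω, ∀ y₀ ∈ Ωs, ∀ y₁ ∈ Ωs, ∀ θ ∈ Ioo (0:ℝ) 1, ∀ yθ ∈ Ωs,
    P x₀ yθ = (1 - θ) • (P x₀ y₀) + θ • (P x₀ y₁) →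
    ∃ η : ℝ → ℝ, Tendsto η (𝓝[>] (0:ℝ)) (𝓝 0) ∧
      ∀ x ∈ Ω, max (c x₀ y₀ - c x y₀) (c x₀ y₁ - c x y₁) ≥
        c x₀ yθ - c x yθ - η ‖x - x₀‖ * ‖x - x₀‖ ^ 2

namespace Dat

variable {H : Type*} [NormedAddCommGroup H] [InnerProductSpace ℝ H] [FiniteDimensional ℝ H]
  {Ω Ωs : Set H} {c : H → H → ℝ} {P q : H → H → H} {A M : H → H → H →L[ℝ] H}

lemma cP (D : Dat Ω Ωs c P q A M) : ∀ x ∈ Ω, ∀ y ∈ Ωs,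
    ContinuousAt (fun z : H × H => P z.1 z.2) (x, y) :=
  fun x hx y hy => (D.P' x hx y hy).hasFDerivAt.continuousAt

lemma Px (D : Dat Ω Ωs c P q A M) {x y : H} (hx : x ∈ Ω) (hy : y ∈ Ωs) :
    HasFDerivAt (fun x => P x y) (A x y) x := by
  have h := (D.P' x hx y hy).hasFDerivAt
  have h2 : HasFDerivAt (fun x' : H => (x', y)) (ContinuousLinearMap.inl ℝ H H) x :=
    hasFDerivAt_prodMk_left x y
  have h3 := HasFDerivAt.comp x h h2
  simpa [Function.comp_def] using h3

lemma Py (D : Dat Ω Ωs c P q A M) {x y : H} (hx : x ∈ Ω) (hy : y ∈ Ωs) :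
    HasFDerivAt (fun y => P x y) (M x y) y := by
  have h := (D.P' x hx y hy).hasFDerivAt
  have h2 : HasFDerivAt (fun y' : H => (x, y')) (ContinuousLinearMap.inr ℝ H H) y :=
    hasFDerivAt_prodMk_right x y
  have h3 := HasFDerivAt.comp y h h2
  simpa [Function.comp_def] using h3

lemma Pyc (D : Dat Ω Ωs c P q A M) {x y : H} (hx : x ∈ Ω) (hy : y ∈ Ωs) :
    HasStrictFDerivAt (fun y => P x y) (M x y) y := by
  have h := (D.P' x hx y hy)
  have h2 : HasStrictFDerivAt (fun y' : H => (x, y')) (ContinuousLinearMap.inr ℝ H H) y :=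
    (hasStrictFDerivAt_const x y).prodMk (hasStrictFDerivAt_id y)
  have h3 := HasStrictFDerivAt.comp y h h2
  simpa [Function.comp_def] using h3

/-- second order expansion -/
lemma lim (D : Dat Ω Ωs c P q A M) {x y : H} (hx : x ∈ Ω) (hy : y ∈ Ωs) (ξ ζ : H) :
    Tendsto (fun t : ℝ => (c x y - c (x + t • ξ + t ^ 2 • ζ) y - t * inner ℝ (P x y) ξ) / t ^ 2)
      (𝓝[>] 0) (𝓝 (inner ℝ (P x y) ζ + inner ℝ (A x y ξ) ξ / 2)) := by
  set γ : ℝ → H := fun t => x + t • ξ + t ^ 2 • ζ with hγ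
  have hγ' : ∀ t, HasDerivAt γ (ξ + (2 * t) • ζ) t := by
    intro t
    have h1 : HasDerivAt (fun t : ℝ => t • ξ) ((1:ℝ) • ξ) t := (hasDerivAt_id t).smul_const ξ
    have h2 : HasDerivAt (fun t : ℝ => t ^ 2 • ζ) ((2 * t) • ζ) t := by
      simpa using (hasDerivAt_pow 2 t).smul_const ζ
    have := (h1.const_add x).add h2
    rw [one_smul] at this
    exact this
  have hγ0 : γ 0 = x := by simp [hγ]
  have hmem : ∀ᶠ t in 𝓝 (0:ℝ), γ t ∈ Ω := by
    have : ContinuousAt γ 0 := (hγ' 0).continuousAt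
    exact this.eventually_mem (by rw [hγ0]; exact D.oΩ.mem_nhds hx)
  have hmem' : ∀ᶠ t in 𝓝[>] (0:ℝ), γ t ∈ Ω := hmem.filter_mono nhdsWithin_le_nhds
  have hf' : ∀ t, γ t ∈ Ω → HasDerivAt (fun t : ℝ => c x y - c (γ t) y - t * inner ℝ (P x y) ξ)
      (inner ℝ (P (γ t) y) (ξ + (2 * t) • ζ) - inner ℝ (P x y) ξ) t := by
    intro t ht
    have h1 := (D.cx _ ht y hy).comp_hasDerivAt t (hγ' t)
    have h2 := (h1.const_sub (c x y)).sub ((hasDerivAt_id t).mul_const (inner ℝ (P x y) ξ))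
    refine h2.congr_deriv ?_
    simp
  refine HasDerivAt.lhopital_zero_nhdsGT (g' := fun t => 2 * t)
    (f' := fun t => inner ℝ (P (γ t) y) (ξ + (2 * t) • ζ) - inner ℝ (P x y) ξ) ?_ ?_ ?_ ?_ ?_ ?_
  · filter_upwards [hmem'] with t ht using hf' t ht
  · filter_upwards with t
    simpa using hasDerivAt_pow 2 t
  · filter_upwards [self_mem_nhdsWithin] with t ht
    have : (0:ℝ) < t := ht
    positivity
  · have := (hf' 0 (by rw [hγ0]; exact hx)).continuousAt.tendsto
    simp only [hγ0] at this
    simp only [sub_self, zero_mul] at this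
    exact this.mono_left nhdsWithin_le_nhds
  · have : Tendsto (fun t : ℝ => t ^ 2) (𝓝 0) (𝓝 (0 ^ 2)) := (continuous_pow 2).tendsto 0
    simp only [ne_eq, OfNat.ofNat_ne_zero, not_false_eq_true, zero_pow] at this
    exact this.mono_left nhdsWithin_le_nhds
  · have h1 : HasDerivAt (fun t => P (γ t) y) (A x y ξ) 0 := by
      have h0 : HasFDerivAt (fun x => P x y) (A x y) (γ 0) := by rw [hγ0]; exact D.Px hx hy
      have := h0.comp_hasDerivAt 0 (hγ' 0)
      simpa [Function.comp_def] using this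
    have h2 : HasDerivAt (fun t : ℝ => ξ + (2 * t) • ζ) ((2:ℝ) • ζ) 0 := by
      have : HasDerivAt (fun t : ℝ => 2 * t) 2 0 := by
        simpa using (hasDerivAt_id (0:ℝ)).const_mul 2
      simpa using (this.smul_const ζ).const_add ξ
    have h3 := (h1.inner ℝ h2).tendsto_slope_zero_right
    have h4 := h3.const_mul (1/2 : ℝ)
    simp only [hγ0, zero_add, mul_zero, zero_smul, add_zero] at h4
    convert h4 using 1
    · ext t
      simp only [smul_eq_mul]
      by_cases ht : t = 0
      · simp [ht]
      · field_simp
    · rw [inner_smul_right]; congr 1; ring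

/-- MTW in integrated form -/
lemma stepA (D : Dat Ω Ωs c P q A M) {x y₀ y₁ yθ ξ : H} {θ : ℝ} (hx : x ∈ Ω) (hy0 : y₀ ∈ Ωs)
    (hy1 : y₁ ∈ Ωs) (hyθ : yθ ∈ Ωs) (hθ : θ ∈ Ioo (0:ℝ) 1)
    (hp : P x yθ = (1 - θ) • (P x y₀) + θ • (P x y₁))
    (hξ : inner ℝ (P x y₁ - P x y₀) ξ = 0) :
    inner ℝ (A x yθ ξ) ξ ≤ (1 - θ) * inner ℝ (A x y₀ ξ) ξ + θ * inner ℝ (A x y₁ ξ) ξ := by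
  by_cases hξ0 : ξ = 0
  · simp [hξ0]
  by_cases h01 : P x y₁ = P x y₀
  · have e1 : y₁ = y₀ := D.injP x hx hy1 hy0 h01
    have e2 : yθ = y₀ := by
      apply D.injP x hx hyθ hy0
      rw [hp, h01]; module
    rw [e1, e2]; apply le_of_eq; ring
  set d := P x y₁ - P x y₀ with hd
  have hd0 : d ≠ 0 := sub_ne_zero.mpr h01
  have hdd : inner ℝ d d ≠ 0 := by simpa using hd0
  set lam : ℝ := (inner ℝ (A x y₀ ξ) ξ - inner ℝ (A x y₁ ξ) ξ) / 2 / inner ℝ d d with hlam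
  set ζ := lam • d with hζ
  obtain ⟨η, hη, hmax⟩ := D.a3v x hx y₀ hy0 y₁ hy1 θ hθ yθ hyθ hp
  set γ : ℝ → H := fun t => x + t • ξ + t ^ 2 • ζ with hγ
  have hγc : Continuous γ := by fun_prop
  have hγ0 : γ 0 = x := by simp [hγ]
  have hmem : ∀ᶠ t in 𝓝[>] (0:ℝ), γ t ∈ Ω :=
    (hγc.continuousAt.eventually_mem (by rw [hγ0]; exact D.oΩ.mem_nhds hx)).filter_mono
      nhdsWithin_le_nhds
  have hdiff : ∀ t, γ t - x = t • (ξ + t • ζ) := by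
    intro t; simp only [hγ]; module
  have hnt : Tendsto (fun t : ℝ => ‖ξ + t • ζ‖) (𝓝[>] 0) (𝓝 ‖ξ‖) := by
    have : Continuous (fun t : ℝ => ‖ξ + t • ζ‖) := by fun_prop
    have := this.tendsto 0
    simp only [zero_smul, add_zero] at this
    exact this.mono_left nhdsWithin_le_nhds
  have hpos : ∀ᶠ t in 𝓝[>] (0:ℝ), 0 < ‖ξ + t • ζ‖ :=
    hnt.eventually (lt_mem_nhds (norm_pos_iff.mpr hξ0))
  have hηt : Tendsto (fun t => η ‖γ t - x‖) (𝓝[>] 0) (𝓝 0) := by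
    apply hη.comp
    apply tendsto_nhdsWithin_of_tendsto_nhds_of_eventually_within
    · have : Continuous (fun t : ℝ => ‖γ t - x‖) := by fun_prop
      have := this.tendsto 0
      simp only [hγ0, sub_self, norm_zero] at this
      exact this.mono_left nhdsWithin_le_nhds
    · filter_upwards [hpos, self_mem_nhdsWithin] with t h1 h2
      have h2 : (0:ℝ) < t := h2
      rw [hdiff, norm_smul]
      simp only [mem_Ioi, Real.norm_eq_abs, abs_of_pos h2]
      positivity
  have herr : Tendsto (fun t => η ‖γ t - x‖ * ‖ξ + t • ζ‖ ^ 2) (𝓝[>] 0) (𝓝 0) := by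
    simpa using hηt.mul (hnt.pow 2)
  have hi0 := D.lim hx hy0 ξ ζ
  have hi1 := D.lim hx hy1 ξ ζ
  have hiθ := D.lim hx hyθ ξ ζ
  have e1 : inner ℝ (P x y₁) ξ = inner ℝ (P x y₀) ξ := by
    rw [hd, inner_sub_left] at hξ; linarith
  have eθ : inner ℝ (P x yθ) ξ = inner ℝ (P x y₀) ξ := by
    rw [hp, inner_add_left, inner_smul_left, inner_smul_left, e1]
    simp only [conj_trivial]; ring
  have hlim := le_of_tendsto_of_tendsto (hiθ.sub herr) (hi0.max hi1) (by
    filter_upwards [hmem, self_mem_nhdsWithin] with t h1 h2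
    have h2 : (0:ℝ) < t := h2
    have h3 := hmax (γ t) h1
    rw [e1, eθ]
    have h4 : ‖γ t - x‖ ^ 2 = t ^ 2 * ‖ξ + t • ζ‖ ^ 2 := by
      rw [hdiff, norm_smul, mul_pow]; simp
    have ht2 : 0 < t ^ 2 := by positivity
    have key : ∀ a b e k : ℝ, a - k ≥ b - k - e * t ^ 2 → b / t ^ 2 - k / t ^ 2 - e ≤ a / t ^ 2 - k / t ^ 2 := by
      intro a b e k h
      have : (b - k - e * t ^ 2) / t ^ 2 ≤ (a - k) / t ^ 2 := by gcongr
      have e2 : (b - k - e * t ^ 2) / t ^ 2 = b / t ^ 2 - k / t ^ 2 - e := by field_simp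
      rw [e2, sub_div] at this
      exact this
    simp only [sub_div _ (t * _)]
    rcases le_max_iff.mp h3 with h | h
    · refine le_max_of_le_left (key _ _ _ _ ?_)
      rw [h4] at h; linarith
    · refine le_max_of_le_right (key _ _ _ _ ?_)
      rw [h4] at h; linarith)
  have eL : inner ℝ (P x y₁) ζ = inner ℝ (P x y₀) ζ + (inner ℝ (A x y₀ ξ) ξ - inner ℝ (A x y₁ ξ) ξ) / 2 := by
    have : inner ℝ d ζ = (inner ℝ (A x y₀ ξ) ξ - inner ℝ (A x y₁ ξ) ξ) / 2 := by
      rw [hζ, inner_smul_right, hlam]; field_simp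
    rw [← this, hd, inner_sub_left]; ring
  have eT : inner ℝ (P x yθ) ζ = (1 - θ) * inner ℝ (P x y₀) ζ + θ * inner ℝ (P x y₁) ζ := by
    rw [hp, inner_add_left, inner_smul_left, inner_smul_left]; simp
  rw [eT, eL, show inner ℝ (P x y₀) ζ + (inner ℝ (A x y₀ ξ) ξ - inner ℝ (A x y₁ ξ) ξ) / 2 +
    inner ℝ (A x y₁ ξ) ξ / 2 = inner ℝ (P x y₀) ζ + inner ℝ (A x y₀ ξ) ξ / 2 by ring, max_self] at hlim
  linarith

/-- openness of `(x,y) ↦ (x, P x y)` -/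
lemma psi (D : Dat Ω Ωs c P q A M) {x y : H} (hx : x ∈ Ω) (hy : y ∈ Ωs) {O : Set H} (hO : O ∈ 𝓝 y) :
    ∀ᶠ z : H × H in 𝓝 (x, P x y), ∃ y' ∈ O, P z.1 y' = z.2 := by
  have h := (D.P' x hx y hy)
  have h1 : HasStrictFDerivAt (fun z : H × H => (z.1, P z.1 z.2))
      ((ContinuousLinearMap.fst ℝ H H).prod ((A x y).coprod (M x y))) (x, y) :=
    hasStrictFDerivAt_fst.prodMk h
  have hsurj : ((ContinuousLinearMap.fst ℝ H H).prod ((A x y).coprod (M x y))).range = ⊤ := by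
    rw [LinearMap.range_eq_top]
    rintro ⟨a, b⟩
    obtain ⟨v, hv⟩ := (D.bij x hx y hy).2 (b - A x y a)
    exact ⟨(a, v), by simp [hv]⟩
  have h2 := h1.map_nhds_eq_of_surj hsurj
  have h3 : (univ ×ˢ O : Set (H × H)) ∈ 𝓝 (x, y) := prod_mem_nhds univ_mem hO
  have h4 := image_mem_map (m := fun z : H × H => (z.1, P z.1 z.2)) h3
  rw [h2] at h4
  filter_upwards [h4] with z hz
  obtain ⟨⟨a, b⟩, ⟨_, hb⟩, rfl⟩ := hz
  exact ⟨b, hb, rfl⟩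

end Dat


section
variable {H : Type*} [NormedAddCommGroup H] [InnerProductSpace ℝ H]

/-- admissible accelerations -/
def Adm (Ωs : Set H) (P : H → H → H) (A : H → H → H →L[ℝ] H) (y₀ x ξ V : H) : Prop :=
  ∀ y ∈ Ωs, inner ℝ (P x y - P x y₀) ξ = 0 →
    0 ≤ inner ℝ (A x y ξ) ξ - inner ℝ (A x y₀ ξ) ξ + inner ℝ (P x y - P x y₀) V

def prj (ξ w : H) : H := w - (inner ℝ ξ w / inner ℝ ξ ξ) • ξ

lemma prj_inner {ξ : H} (hξ : ξ ≠ 0) (w : H) : inner ℝ (prj ξ w) ξ = 0 := by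
  have : inner ℝ ξ ξ ≠ 0 := by simpa using hξ
  rw [prj, inner_sub_left, inner_smul_left, real_inner_comm]
  simp only [conj_trivial]; field_simp; ring

lemma prj_of_perp {ξ w : H} (h : inner ℝ w ξ = 0) : prj ξ w = w := by
  rw [prj, real_inner_comm, h]; simp

lemma prj_self {ξ : H} (hξ : ξ ≠ 0) (t : ℝ) : prj ξ (t • ξ) = 0 := by
  have : inner ℝ ξ ξ ≠ 0 := by simpa using hξ
  rw [prj, inner_smul_right, mul_div_assoc, div_self this]; simp

lemma prj_comb (ξ u v : H) (a b : ℝ) : prj ξ (a • u + b • v) = a • prj ξ u + b • prj ξ v := by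
  simp only [prj, inner_add_right, inner_smul_right, add_div, mul_div_assoc]
  module

lemma prj_cont (ξ : H) : Continuous (prj ξ) := by
  unfold prj; fun_prop
end

namespace Dat

variable {H : Type*} [NormedAddCommGroup H] [InnerProductSpace ℝ H] [FiniteDimensional ℝ H]
  {Ω Ωs : Set H} {c : H → H → ℝ} {P q : H → H → H} {A M : H → H → H →L[ℝ] H}

lemma cA_comp (D : Dat Ω Ωs c P q A M) {X : Type*} [TopologicalSpace X] {a b : X → H} {w0 : X}
    (ha : ContinuousAt a w0) (hb : ContinuousAt b w0) (hx : a w0 ∈ Ω) (hy : b w0 ∈ Ωs) :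
    ContinuousAt (fun w => A (a w) (b w)) w0 :=
  Tendsto.comp (g := fun z : H × H => A z.1 z.2) (f := fun w => (a w, b w))
    (D.cA _ hx _ hy) (ha.prodMk hb)

lemma cM_comp (D : Dat Ω Ωs c P q A M) {X : Type*} [TopologicalSpace X] {a b : X → H} {w0 : X}
    (ha : ContinuousAt a w0) (hb : ContinuousAt b w0) (hx : a w0 ∈ Ω) (hy : b w0 ∈ Ωs) :
    ContinuousAt (fun w => M (a w) (b w)) w0 :=
  Tendsto.comp (g := fun z : H × H => M z.1 z.2) (f := fun w => (a w, b w))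
    (D.cM _ hx _ hy) (ha.prodMk hb)

lemma cP_comp (D : Dat Ω Ωs c P q A M) {X : Type*} [TopologicalSpace X] {a b : X → H} {w0 : X}
    (ha : ContinuousAt a w0) (hb : ContinuousAt b w0) (hx : a w0 ∈ Ω) (hy : b w0 ∈ Ωs) :
    ContinuousAt (fun w => P (a w) (b w)) w0 :=
  Tendsto.comp (g := fun z : H × H => P z.1 z.2) (f := fun w => (a w, b w))
    (D.cP _ hx _ hy) (ha.prodMk hb)

lemma adm_exists (D : Dat Ω Ωs c P q A M) {x y₀ ξ : H} (hx : x ∈ Ω) (hy0 : y₀ ∈ Ωs) (hξ : ξ ≠ 0) :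
    ∃ V, Adm Ωs P A y₀ x ξ V ∧ inner ℝ V ξ = 0 := by
  set S : Set (H × ℝ) := {z | ∃ y ∈ Ωs, P x y = P x y₀ + prj ξ z.1 ∧ inner ℝ (A x y ξ) ξ < z.2} with hS
  set a0 := inner ℝ (A x y₀ ξ) ξ with ha0
  have hconv : Convex ℝ S := by
    rw [convex_iff_forall_pos]
    rintro ⟨w, s⟩ ⟨y, hy, hpy, hsy⟩ ⟨w', s'⟩ ⟨y', hy', hpy', hsy'⟩ a b ha hb hab
    obtain ⟨y'', hy'', hp''⟩ := D.convP x hx ⟨y, hy, rfl⟩ ⟨y', hy', rfl⟩ ha.le hb.le hab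
    have ha' : a = 1 - b := by linarith
    refine ⟨y'', hy'', ?_, ?_⟩
    · rw [hp'', hpy, hpy']
      simp only [Prod.smul_mk, Prod.mk_add_mk]
      rw [prj_comb, ha']; module
    · have := D.stepA (ξ := ξ) hx hy hy' hy'' (θ := b) ⟨hb, by linarith⟩ (by rw [hp'', ha']) (by
        rw [hpy, hpy', add_sub_add_left_eq_sub, inner_sub_left, prj_inner hξ, prj_inner hξ, sub_zero])
      simp only [Prod.smul_mk, Prod.mk_add_mk, smul_eq_mul]
      rw [← ha'] at this
      have h1 := mul_lt_mul_of_pos_left hsy ha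
      have h2 := mul_lt_mul_of_pos_left hsy' hb
      simp only at h1 h2
      linarith
  have hopen : IsOpen S := by
    rw [isOpen_iff_mem_nhds]
    rintro ⟨w, s⟩ ⟨y, hy, hpy, hsy⟩
    simp only at hpy hsy
    obtain ⟨m, hm1, hm2⟩ := exists_between hsy
    have hc : ContinuousAt (fun y' => inner ℝ (A x y' ξ) ξ) y := by
      have : ContinuousAt (fun y' => A x y') y :=
        D.cA_comp (by fun_prop) (by fun_prop) hx hy
      fun_prop
    have hO := (hc.eventually (gt_mem_nhds hm1)).and (D.oS.mem_nhds hy)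
    have h1 := D.psi hx hy hO
    have h2 : ContinuousAt (fun z : H × ℝ => (x, P x y₀ + prj ξ z.1)) (w, s) := by
      have := (prj_cont ξ).comp (continuous_fst (X := H) (Y := ℝ))
      exact (continuous_const.prodMk (continuous_const.add this)).continuousAt
    have h3 := h2.eventually (p := fun z => ∃ y' ∈ {x_1 | ⟪(A x x_1) ξ, ξ⟫ < m ∧ Ωs x_1}, P z.1 y' = z.2)
      (by simp only; rw [← hpy]; exact h1)
    have h4 : ∀ᶠ z : H × ℝ in 𝓝 (w, s), m < z.2 :=
      (continuous_snd.continuousAt (x := (w, s))).eventually (lt_mem_nhds hm2)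
    filter_upwards [h3, h4] with z hz3 hz4
    obtain ⟨y', ⟨h5, h6⟩, h7⟩ := hz3
    exact ⟨y', h6, h7, h5.trans hz4⟩
  have hnot : ((0 : H), a0) ∉ S := by
    rintro ⟨y, hy, hpy, hsy⟩
    simp only [prj, inner_zero_right, zero_div, zero_smul, sub_zero, add_zero] at hpy
    have := D.injP x hx hy hy0 hpy
    rw [this] at hsy
    exact lt_irrefl _ hsy
  obtain ⟨f, hf⟩ := geometric_hahn_banach_point_open hconv hopen hnot
  have hfd : ∀ (w : H) (s : ℝ), f (w, s) = f (w, 0) + s * f (0, 1) := by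
    intro w s
    have : (w, s) = (w, (0:ℝ)) + s • ((0:H), (1:ℝ)) := by simp
    rw [this, map_add, map_smul]; simp
  set s0 := f (0, 1) with hs0
  have h00 : f ((0:H), (0:ℝ)) = 0 := by
    have : ((0:H), (0:ℝ)) = 0 := rfl
    rw [this, map_zero]
  have hspos : 0 < s0 := by
    have := hf (0, a0 + 1) ⟨y₀, hy0, by simp [prj], by simp [ha0]⟩
    rw [hfd, hfd 0 (a0 + 1), h00] at this
    linarith
  have hξf : f (ξ, 0) = 0 := by
    by_contra hne
    have := hf ((-s0 / f (ξ, 0)) • ξ, a0 + 1) ⟨y₀, hy0, by simp only; rw [prj_self hξ, add_zero],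
      by simp [ha0]⟩
    have h2 : f ((-s0 / f (ξ, 0)) • ξ, 0) = -s0 := by
      have : ((-s0 / f (ξ, 0)) • ξ, (0:ℝ)) = (-s0 / f (ξ, 0)) • (ξ, (0:ℝ)) := by simp
      rw [this, map_smul, smul_eq_mul]; field_simp
    rw [hfd, hfd (_ • ξ), h00, h2] at this
    linarith
  set V : H := (InnerProductSpace.toDual ℝ H).symm (s0⁻¹ • f.comp (ContinuousLinearMap.inl ℝ H ℝ)) with hV
  have hVw : ∀ w, inner ℝ V w = s0⁻¹ * f (w, 0) := by
    intro w
    rw [hV, InnerProductSpace.toDual_symm_apply]; simp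
  refine ⟨V, ?_, by rw [hVw, hξf, mul_zero]⟩
  intro y hy hF
  rw [real_inner_comm V (P x y - P x y₀), hVw]
  have key : a0 * s0 ≤ f (P x y - P x y₀, 0) + inner ℝ (A x y ξ) ξ * s0 := by
    apply le_of_forall_pos_le_add
    intro ε hε
    have := hf (P x y - P x y₀, inner ℝ (A x y ξ) ξ + ε / s0)
      ⟨y, hy, by simp only; rw [prj_of_perp hF]; abel, by simp only; linarith [div_pos hε hspos]⟩
    rw [hfd, hfd (_ - _), h00] at this
    have e : (inner ℝ (A x y ξ) ξ + ε / s0) * s0 = inner ℝ (A x y ξ) ξ * s0 + ε := by field_simp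
    linarith
  have : s0⁻¹ * (a0 * s0) ≤ s0⁻¹ * (f (P x y - P x y₀, 0) + inner ℝ (A x y ξ) ξ * s0) := by gcongr
  have e1 : s0⁻¹ * (a0 * s0) = a0 := by field_simp
  have e2 : s0⁻¹ * (f (P x y - P x y₀, 0) + inner ℝ (A x y ξ) ξ * s0) =
    s0⁻¹ * f (P x y - P x y₀, 0) + inner ℝ (A x y ξ) ξ := by field_simp
  linarith

lemma cPhi (D : Dat Ω Ωs c P q A M) {x y ξ : H} (hx : x ∈ Ω) (hy : y ∈ Ωs) :
    ContinuousAt (fun z : (H × H) × H => inner ℝ (A z.1.1 z.2 z.1.2) z.1.2) ((x, ξ), y) := by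
  have : ContinuousAt (fun z : (H × H) × H => A z.1.1 z.2) ((x, ξ), y) :=
    D.cA_comp (by fun_prop) (by fun_prop) hx hy
  exact (this.clm_apply (by fun_prop)).inner (𝕜 := ℝ) (by fun_prop)

lemma adm_bound (D : Dat Ω Ωs c P q A M) {x y₀ ξ : H} (hx : x ∈ Ω) (hy0 : y₀ ∈ Ωs) (hξ : ξ ≠ 0) :
    ∃ R > 0, ∀ᶠ z : H × H in 𝓝 (x, ξ), ∃ V, ‖V‖ ≤ R ∧ Adm Ωs P A y₀ z.1 z.2 V := by
  set C0 := inner ℝ (A x y₀ ξ) ξ with hC0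
  have h1 := (D.cPhi (ξ := ξ) hx hy0).eventually (gt_mem_nhds (show C0 < C0 + 1 by linarith))
  have h1' := (D.cPhi (ξ := ξ) hx hy0).eventually (lt_mem_nhds (show C0 - 1 < C0 by linarith))
  have h2 := h1.and h1'
  rw [nhds_prod_eq, eventually_prod_iff] at h2
  obtain ⟨pa, hpa, pb, hpb, hpp⟩ := h2
  have h3 := D.psi hx hy0 (hpb.and (D.oS.mem_nhds hy0))
  obtain ⟨r, hr, h4⟩ := Metric.eventually_nhds_iff.mp h3
  refine ⟨4 / r, by positivity, ?_⟩
  have hcont : ContinuousAt (fun z : H × H => P z.1 y₀) (x, ξ) :=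
    D.cP_comp (by fun_prop) (by fun_prop) hx hy0
  have h5 : ∀ᶠ z : H × H in 𝓝 (x, ξ), dist (P z.1 y₀) (P x y₀) < r / 2 :=
    hcont.eventually (Metric.ball_mem_nhds _ (by positivity))
  have h6 : ∀ᶠ z : H × H in 𝓝 (x, ξ), dist z.1 x < r :=
    continuous_fst.continuousAt.eventually (Metric.ball_mem_nhds _ hr)
  have h7 : ∀ᶠ z : H × H in 𝓝 (x, ξ), z.1 ∈ Ω :=
    continuous_fst.continuousAt.eventually (D.oΩ.mem_nhds hx)
  have h8 : ∀ᶠ z : H × H in 𝓝 (x, ξ), z.2 ≠ 0 :=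
    continuous_snd.continuousAt.eventually_ne hξ
  filter_upwards [h5, h6, h7, h8, hpa] with z h5 h6 h7 h8 h9
  obtain ⟨V, hV, hVξ⟩ := D.adm_exists h7 hy0 h8
  refine ⟨V, ?_, hV⟩
  by_cases hV0 : V = 0
  · rw [hV0, norm_zero]; positivity
  have hVp : 0 < ‖V‖ := norm_pos_iff.mpr hV0
  set p := P z.1 y₀ - (r / 2 / ‖V‖) • V with hp
  have hdp : dist (z.1, p) (x, P x y₀) < r := by
    rw [Prod.dist_eq, max_lt_iff]
    refine ⟨h6, ?_⟩
    simp only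
    have e : dist p (P z.1 y₀) = r / 2 := by
      rw [dist_eq_norm, hp, sub_sub_cancel_left, norm_neg, norm_smul, Real.norm_eq_abs,
        abs_of_pos (by positivity)]
      field_simp
    calc dist p (P x y₀) ≤ dist p (P z.1 y₀) + dist (P z.1 y₀) (P x y₀) := dist_triangle _ _ _
      _ < r := by linarith
  obtain ⟨y', ⟨hy'1, hy'2⟩, hy'3⟩ := h4 hdp
  simp only at hy'3
  have hF : inner ℝ (P z.1 y' - P z.1 y₀) z.2 = 0 := by
    rw [hy'3, hp, sub_sub_cancel_left, inner_neg_left, inner_smul_left, hVξ]; simp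
  have h10 := hV y' hy'2 hF
  have e2 : inner ℝ (P z.1 y' - P z.1 y₀) V = - (r / 2 * ‖V‖) := by
    rw [hy'3, hp, sub_sub_cancel_left, inner_neg_left, inner_smul_left, real_inner_self_eq_norm_sq]
    simp only [conj_trivial]; field_simp
  rw [e2] at h10
  have h11 := hpp h9 hy'1
  have h12 := hpp h9 hpb.self_of_nhds
  simp only at h11 h12
  rw [le_div_iff₀ hr]
  linarith [h11.1, h12.2]

lemma adm_not_nhds (D : Dat Ω Ωs c P q A M) {x y₀ ξ V : H} (hx : x ∈ Ω) (hy0 : y₀ ∈ Ωs)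
    (hξ : ξ ≠ 0) (hn : ¬ Adm Ωs P A y₀ x ξ V) :
    ∀ᶠ z : H × H × H in 𝓝 (x, ξ, V), ¬ Adm Ωs P A y₀ z.1 z.2.1 z.2.2 := by
  unfold Adm at hn
  push Not at hn
  obtain ⟨y, hy, hF, hneg⟩ := hn
  have hcont : ContinuousAt (fun w : (H × H × H) × H =>
      inner ℝ (A w.1.1 w.2 w.1.2.1) w.1.2.1 - inner ℝ (A w.1.1 y₀ w.1.2.1) w.1.2.1 +
        inner ℝ (P w.1.1 w.2 - P w.1.1 y₀) w.1.2.2) ((x, ξ, V), y) := by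
    have a1 : ContinuousAt (fun w : (H × H × H) × H => A w.1.1 w.2) ((x, ξ, V), y) :=
      D.cA_comp (by fun_prop) (by fun_prop) hx hy
    have a2 : ContinuousAt (fun w : (H × H × H) × H => A w.1.1 y₀) ((x, ξ, V), y) :=
      D.cA_comp (by fun_prop) (by fun_prop) hx hy0
    have a3 : ContinuousAt (fun w : (H × H × H) × H => P w.1.1 w.2) ((x, ξ, V), y) :=
      D.cP_comp (by fun_prop) (by fun_prop) hx hy
    have a4 : ContinuousAt (fun w : (H × H × H) × H => P w.1.1 y₀) ((x, ξ, V), y) :=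
      D.cP_comp (by fun_prop) (by fun_prop) hx hy0
    exact (((a1.clm_apply (by fun_prop)).inner (𝕜 := ℝ) (by fun_prop)).sub
      ((a2.clm_apply (by fun_prop)).inner (𝕜 := ℝ) (by fun_prop))).add
      ((a3.sub a4).inner (𝕜 := ℝ) (by fun_prop))
  have h2 := hcont.eventually (gt_mem_nhds hneg)
  rw [nhds_prod_eq, eventually_prod_iff] at h2
  obtain ⟨pa, hpa, pb, hpb, hpp⟩ := h2
  have h3 := D.psi hx hy (hpb.and (D.oS.mem_nhds hy))
  have hcp : ContinuousAt (fun z : H × H × H => (z.1, P z.1 y₀ + prj z.2.1 (P x y - P x y₀))) (x, ξ, V) := by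
    have a4 : ContinuousAt (fun w : H × H × H => P w.1 y₀) (x, ξ, V) :=
      D.cP_comp (by fun_prop) (by fun_prop) hx hy0
    have : inner ℝ ξ ξ ≠ 0 := by simpa using hξ
    unfold prj
    refine ContinuousAt.prodMk (by fun_prop) (a4.add (ContinuousAt.sub (by fun_prop) ?_))
    exact ContinuousAt.smul (ContinuousAt.div (by fun_prop) (by fun_prop) this) (by fun_prop)
  have h4 := hcp.eventually (p := fun z => ∃ y' ∈ {x | pb x ∧ Ωs x}, P z.1 y' = z.2) (by
    simp only; rw [prj_of_perp hF, add_sub_cancel]; exact h3)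
  have h8 : ∀ᶠ z : H × H × H in 𝓝 (x, ξ, V), z.2.1 ≠ 0 :=
    (by fun_prop : ContinuousAt (fun z : H × H × H => z.2.1) (x, ξ, V)).eventually (isOpen_ne.mem_nhds hξ)
  filter_upwards [hpa, h4, h8] with z hz1 hz2 hz3 hadm
  obtain ⟨y', ⟨hy1, hy2⟩, hy3⟩ := hz2
  have := hadm y' hy2 (by rw [hy3, add_sub_cancel_left, prj_inner hz3])
  have h9 := hpp hz1 hy1
  simp only at h9
  linarith

/-- derivative of `F` along the Euler step -/
def DD (P : H → H → H) (A : H → H → H →L[ℝ] H) (y₀ x ξ V y : H) (τ : ℝ) : ℝ :=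
  inner ℝ ((A (x + τ • ξ) y - A (x + τ • ξ) y₀) ξ) (ξ + τ • V) +
    inner ℝ (P (x + τ • ξ) y - P (x + τ • ξ) y₀) V

lemma DD_cont (D : Dat Ω Ωs c P q A M) {x y₀ ξ V y : H} {τ : ℝ} (hx : x + τ • ξ ∈ Ω) (hy0 : y₀ ∈ Ωs)
    (hy : y ∈ Ωs) : ContinuousAt (fun w : H × H × H × H × ℝ =>
      DD P A y₀ w.1 w.2.1 w.2.2.1 w.2.2.2.1 w.2.2.2.2) (x, ξ, V, y, τ) := by
  have a1 : ContinuousAt (fun w : H × H × H × H × ℝ => A (w.1 + w.2.2.2.2 • w.2.1) w.2.2.2.1) (x, ξ, V, y, τ) :=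
      D.cA_comp (by fun_prop) (by fun_prop) hx hy
  have a2 : ContinuousAt (fun w : H × H × H × H × ℝ => A (w.1 + w.2.2.2.2 • w.2.1) y₀) (x, ξ, V, y, τ) :=
      D.cA_comp (by fun_prop) (by fun_prop) hx hy0
  have a3 : ContinuousAt (fun w : H × H × H × H × ℝ => P (w.1 + w.2.2.2.2 • w.2.1) w.2.2.2.1) (x, ξ, V, y, τ) :=
      D.cP_comp (by fun_prop) (by fun_prop) hx hy
  have a4 : ContinuousAt (fun w : H × H × H × H × ℝ => P (w.1 + w.2.2.2.2 • w.2.1) y₀) (x, ξ, V, y, τ) :=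
      D.cP_comp (by fun_prop) (by fun_prop) hx hy0
  exact (((a1.sub a2).clm_apply (by fun_prop)).inner (𝕜 := ℝ) (by fun_prop)).add
      ((a3.sub a4).inner (𝕜 := ℝ) (by fun_prop))

lemma unif (D : Dat Ω Ωs c P q A M) {y₀ : H} (hy0 : y₀ ∈ Ωs) {KX Kξ KV Ky : Set H} {τ₁ : ℝ}
    (hKX : IsCompact KX) (hKξ : IsCompact Kξ) (hKV : IsCompact KV) (hKy : IsCompact Ky)
    (sX : KX ⊆ Ω) (sξ : ∀ ξ ∈ Kξ, ξ ≠ 0) (sy : Ky ⊆ Ωs)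
    (sτ : ∀ x ∈ KX, ∀ ξ ∈ Kξ, ∀ τ ∈ Icc 0 τ₁, x + τ • ξ ∈ Ω) :
    (∃ C, ∀ x ∈ KX, ∀ ξ ∈ Kξ, ∀ V ∈ KV, ∀ y ∈ Ky, ∀ τ ∈ Icc 0 τ₁, |DD P A y₀ x ξ V y τ| ≤ C) ∧
    ∀ ε > 0, ∃ δ > 0, ∀ x ∈ KX, ∀ ξ ∈ Kξ, ∀ V ∈ KV, ∀ y ∈ Ky, ∀ τ ∈ Icc 0 τ₁,
      Adm Ωs P A y₀ x ξ V → |inner ℝ (P x y - P x y₀) ξ| ≤ δ → τ ≤ δ → -ε ≤ DD P A y₀ x ξ V y τ := by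
  set K : Set (H × H × H × H × ℝ) := KX ×ˢ Kξ ×ˢ KV ×ˢ Ky ×ˢ Icc 0 τ₁ with hK
  have cK : IsCompact K := hKX.prod (hKξ.prod (hKV.prod (hKy.prod isCompact_Icc)))
  have hDc : ∀ w ∈ K, ContinuousAt (fun w : H × H × H × H × ℝ =>
      DD P A y₀ w.1 w.2.1 w.2.2.1 w.2.2.2.1 w.2.2.2.2) w := by
    rintro ⟨x, ξ, V, y, τ⟩ ⟨h1, h2, h3, h4, h5⟩
    exact D.DD_cont (sτ x h1 ξ h2 τ h5) hy0 (sy h4)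
  have hDon : ContinuousOn (fun w : H × H × H × H × ℝ =>
      DD P A y₀ w.1 w.2.1 w.2.2.1 w.2.2.2.1 w.2.2.2.2) K :=
    fun w hw => (hDc w hw).continuousWithinAt
  constructor
  · obtain ⟨C, hC⟩ := cK.exists_bound_of_continuousOn hDon
    exact ⟨C, fun x h1 ξ h2 V h3 y h4 τ h5 => hC (x, ξ, V, y, τ) ⟨h1, h2, h3, h4, h5⟩⟩
  intro ε hε
  set Z : Set (H × H × H × H × ℝ) := {w | w ∈ K ∧ Adm Ωs P A y₀ w.1 w.2.1 w.2.2.1 ∧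
    DD P A y₀ w.1 w.2.1 w.2.2.1 w.2.2.2.1 w.2.2.2.2 ≤ -ε} with hZ
  have hZc : IsClosed Z := by
    rw [← isOpen_compl_iff, isOpen_iff_mem_nhds]
    rintro w hw
    by_cases hwK : w ∈ K
    · by_cases hA : Adm Ωs P A y₀ w.1 w.2.1 w.2.2.1
      · have : -ε < DD P A y₀ w.1 w.2.1 w.2.2.1 w.2.2.2.1 w.2.2.2.2 := by
          by_contra hcon
          exact hw ⟨hwK, hA, not_lt.mp hcon⟩
        filter_upwards [(hDc w hwK).eventually (lt_mem_nhds this)] with v hv hvZ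
        exact absurd hvZ.2.2 (not_le.mpr hv)
      · have h1 := D.adm_not_nhds (sX hwK.1) hy0 (sξ _ hwK.2.1) hA
        have h2 : ContinuousAt (fun w : H × H × H × H × ℝ => (w.1, w.2.1, w.2.2.1)) w := by fun_prop
        filter_upwards [h2.eventually h1] with v hv hvZ
        exact hv hvZ.2.1
    · filter_upwards [cK.isClosed.isOpen_compl.mem_nhds hwK] with v hv hvZ
      exact hv hvZ.1
  have hZcomp : IsCompact Z := cK.of_isClosed_subset hZc (fun w hw => hw.1)
  set G : H × H × H × H × ℝ → ℝ := fun w =>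
    |inner ℝ (P w.1 w.2.2.2.1 - P w.1 y₀) w.2.1| + w.2.2.2.2 with hG
  have hGc : ContinuousOn G Z := by
    rintro ⟨x, ξ, V, y, τ⟩ ⟨⟨h1, h2, h3, h4, h5⟩, -⟩
    have a3 : ContinuousAt (fun w : H × H × H × H × ℝ => P w.1 w.2.2.2.1) (x, ξ, V, y, τ) :=
      D.cP_comp (by fun_prop) (by fun_prop) (sX h1) (sy h4)
    have a4 : ContinuousAt (fun w : H × H × H × H × ℝ => P w.1 y₀) (x, ξ, V, y, τ) :=
      D.cP_comp (by fun_prop) (by fun_prop) (sX h1) hy0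
    apply ContinuousAt.continuousWithinAt
    exact ((a3.sub a4).inner (𝕜 := ℝ) (by fun_prop)).abs.add (by fun_prop)
  have hGpos : ∀ w ∈ Z, 0 < G w := by
    rintro ⟨x, ξ, V, y, τ⟩ ⟨⟨h1, h2, h3, h4, h5⟩, hA, hD⟩
    simp only [hG] at *
    by_contra hcon
    have t0 : 0 ≤ τ := h5.1
    have a0 := abs_nonneg (inner ℝ (P x y - P x y₀) ξ)
    have t1 : τ = 0 := by linarith
    have a1 : |inner ℝ (P x y - P x y₀) ξ| = 0 := by linarith
    have := hA y (sy h4) (abs_eq_zero.mp a1)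
    rw [t1] at hD
    simp only [DD, zero_smul, add_zero, sub_apply, inner_sub_left] at hD this
    linarith
  rcases Z.eq_empty_or_nonempty with hE | hne
  · refine ⟨1, one_pos, fun x h1 ξ h2 V h3 y h4 τ h5 hA _ _ => ?_⟩
    by_contra hcon
    have : (x, ξ, V, y, τ) ∈ Z := ⟨⟨h1, h2, h3, h4, h5⟩, hA, (not_le.mp hcon).le⟩
    rw [hE] at this; exact this
  · obtain ⟨w, hw, hmin⟩ := hZcomp.exists_isMinOn hne hGc
    have hp := hGpos w hw
    refine ⟨G w / 3, by positivity, fun x h1 ξ h2 V h3 y h4 τ h5 hA hF hτ => ?_⟩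
    by_contra hcon
    have : (x, ξ, V, y, τ) ∈ Z := ⟨⟨h1, h2, h3, h4, h5⟩, hA, (not_le.mp hcon).le⟩
    have h := hmin this
    simp only [Set.mem_ofPred_eq] at h
    have e : G (x, ξ, V, y, τ) = |inner ℝ (P x y - P x y₀) ξ| + τ := rfl
    rw [e] at h
    linarith

end Dat


section
variable {H : Type*} [NormedAddCommGroup H] [InnerProductSpace ℝ H] [FiniteDimensional ℝ H]

/-- Euler scheme -/
def eul (W : H → H → H) (τ : ℝ) (x ξ : H) : ℕ → H × H
  | 0 => (x, ξ)
  | k + 1 => ((eul W τ x ξ k).1 + τ • (eul W τ x ξ k).2,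
      (eul W τ x ξ k).2 + τ • W (eul W τ x ξ k).1 (eul W τ x ξ k).2)

lemma eul_est (W : H → H → H) {R τ : ℝ} (hW : ∀ x ξ, ‖W x ξ‖ ≤ R) (hτ : 0 ≤ τ) (x ξ : H) (k m : ℕ) :
    ‖(eul W τ x ξ (k + m)).2 - (eul W τ x ξ k).2‖ ≤ m * τ * R ∧
    ‖(eul W τ x ξ (k + m)).1 - (eul W τ x ξ k).1 - (m * τ) • (eul W τ x ξ k).2‖ ≤ (m * τ) ^ 2 * R := by
  have hR : 0 ≤ R := (norm_nonneg _).trans (hW 0 0)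
  induction m with
  | zero => simp
  | succ m ih =>
    obtain ⟨h1, h2⟩ := ih
    have e : k + (m + 1) = (k + m) + 1 := by ring
    rw [e]
    simp only [eul]
    set z := eul W τ x ξ (k + m)
    set w := eul W τ x ξ k
    push_cast
    have hV := hW z.1 z.2
    constructor
    · calc ‖z.2 + τ • W z.1 z.2 - w.2‖ = ‖(z.2 - w.2) + τ • W z.1 z.2‖ := by congr 1; abel
        _ ≤ ‖z.2 - w.2‖ + ‖τ • W z.1 z.2‖ := norm_add_le _ _
        _ ≤ m * τ * R + τ * R := by
          rw [norm_smul, Real.norm_eq_abs, abs_of_nonneg hτ]; gcongr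
        _ = _ := by ring
    · calc ‖z.1 + τ • z.2 - w.1 - ((m + 1 : ℝ) * τ) • w.2‖
          = ‖(z.1 - w.1 - (m * τ) • w.2) + τ • (z.2 - w.2)‖ := by congr 1; module
        _ ≤ ‖z.1 - w.1 - (m * τ) • w.2‖ + ‖τ • (z.2 - w.2)‖ := norm_add_le _ _
        _ ≤ (m * τ) ^ 2 * R + τ * (m * τ * R) := by
          rw [norm_smul, Real.norm_eq_abs, abs_of_nonneg hτ]; gcongr
        _ ≤ ((m + 1) * τ) ^ 2 * R := by
          have h3 : 0 ≤ τ ^ 2 * R := by positivity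
          have h4 : (0:ℝ) ≤ m := by positivity
          nlinarith [mul_nonneg h3 h4]

/-- discrete time index -/
def idx (N : ℕ) (t : ℝ) : ℕ := ⌊t * ((N : ℝ) + 1)⌋₊

def tau (N : ℕ) : ℝ := 1 / ((N : ℝ) + 1)

lemma tau_pos (N : ℕ) : 0 < tau N := by unfold tau; positivity

lemma idx_le {N : ℕ} {t : ℝ} (ht : 0 ≤ t) : idx N t * tau N ≤ t := by
  unfold idx tau
  have := Nat.floor_le (show 0 ≤ t * ((N : ℝ) + 1) by positivity)
  rw [mul_one_div, div_le_iff₀ (by positivity)]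
  exact this

lemma idx_tendsto {t : ℝ} (ht : 0 ≤ t) : Tendsto (fun N => idx N t * tau N) (hyperfilter ℕ) (𝓝 t) := by
  have h1 := tendsto_nat_floor_mul_div_atTop (R := ℝ) ht
  have h2 : Tendsto (fun N : ℕ => (N : ℝ) + 1) atTop atTop :=
    tendsto_atTop_add_const_right _ _ tendsto_natCast_atTop_atTop
  have h3 := (h1.comp h2).mono_left (Nat.hyperfilter_le_atTop)
  refine h3.congr fun N => ?_
  simp [idx, tau, div_eq_mul_inv]

lemma tau_tendsto : Tendsto tau (hyperfilter ℕ) (𝓝 0) :=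
  tendsto_one_div_add_atTop_nhds_zero_nat.mono_left Nat.hyperfilter_le_atTop

lemma idx_mono {N : ℕ} {s t : ℝ} (h : s ≤ t) : idx N s ≤ idx N t := by
  unfold idx; gcongr

lemma ultra_lim {u : ℕ → H} {a : H} {r : ℝ} (h : ∀ N, ‖u N - a‖ ≤ r) :
    ∃ l, Tendsto u (hyperfilter ℕ) (𝓝 l) := by
  have hc : IsCompact (Metric.closedBall a r) := isCompact_closedBall a r
  obtain ⟨l, -, hl⟩ := hc.ultrafilter_le_nhds' ((hyperfilter ℕ).map u) (by
    rw [Ultrafilter.mem_map]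
    filter_upwards with N
    simpa [dist_eq_norm] using h N)
  exact ⟨l, hl⟩

lemma eul_est' (W : H → H → H) {R : ℝ} (hW : ∀ x ξ, ‖W x ξ‖ ≤ R) (x ξ : H) {N i j : ℕ} (hij : i ≤ j) :
    ‖(eul W (tau N) x ξ j).2 - (eul W (tau N) x ξ i).2‖ ≤ (j * tau N - i * tau N) * R ∧
    ‖(eul W (tau N) x ξ j).1 - (eul W (tau N) x ξ i).1 - (j * tau N - i * tau N) • (eul W (tau N) x ξ i).2‖
      ≤ (j * tau N - i * tau N) ^ 2 * R := by
  obtain ⟨m, rfl⟩ := Nat.exists_eq_add_of_le hij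
  have := eul_est W hW (tau_pos N).le x ξ i m
  have e : (((i + m : ℕ) : ℝ) * tau N - i * tau N) = m * tau N := by push_cast; ring
  rw [e]
  exact this

lemma eul_bd (W : H → H → H) {R τ : ℝ} (hW : ∀ x ξ, ‖W x ξ‖ ≤ R) (hτ : 0 ≤ τ) (x ξ : H) {k : ℕ} {t : ℝ}
    (hk : k * τ ≤ t) : ‖(eul W τ x ξ k).2 - ξ‖ ≤ t * R ∧ ‖(eul W τ x ξ k).1 - x‖ ≤ t * ‖ξ‖ + t ^ 2 * R := by
  have hR : 0 ≤ R := (norm_nonneg _).trans (hW 0 0)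
  have h := eul_est W hW hτ x ξ 0 k
  simp only [zero_add, eul] at h
  have h0 : 0 ≤ k * τ := by positivity
  constructor
  · exact h.1.trans (by gcongr)
  · calc _ = ‖((eul W τ x ξ k).1 - x - (k * τ) • ξ) + (k * τ) • ξ‖ := by congr 1; abel
      _ ≤ ‖(eul W τ x ξ k).1 - x - (k * τ) • ξ‖ + ‖(k * τ) • ξ‖ := norm_add_le _ _
      _ ≤ (k * τ) ^ 2 * R + (k * τ) * ‖ξ‖ := by
        rw [norm_smul, Real.norm_eq_abs, abs_of_nonneg h0]; linarith [h.2]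
      _ ≤ t ^ 2 * R + t * ‖ξ‖ := by gcongr
      _ = _ := by ring

lemma euler_lim (W : H → H → H) {R : ℝ} (hW : ∀ x ξ, ‖W x ξ‖ ≤ R) (x ξ : H) :
    ∃ X Ξ : ℝ → H,
      (∀ t, 0 ≤ t → Tendsto (fun N => (eul W (tau N) x ξ (idx N t)).1) (hyperfilter ℕ) (𝓝 (X t))) ∧
      (∀ t, 0 ≤ t → Tendsto (fun N => (eul W (tau N) x ξ (idx N t)).2) (hyperfilter ℕ) (𝓝 (Ξ t))) ∧
      X 0 = x ∧ Ξ 0 = ξ ∧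
      ∀ s t, 0 ≤ s → s ≤ t → ‖Ξ t - Ξ s‖ ≤ (t - s) * R ∧ ‖X t - X s - (t - s) • Ξ s‖ ≤ (t - s) ^ 2 * R := by
  have e1 : ∀ t, ∃ l, 0 ≤ t → Tendsto (fun N => (eul W (tau N) x ξ (idx N t)).1) (hyperfilter ℕ) (𝓝 l) := by
    intro t
    by_cases ht : 0 ≤ t
    · obtain ⟨l, hl⟩ := ultra_lim (fun N => (eul_bd W hW (tau_pos N).le x ξ (idx_le (N := N) ht)).2)
      exact ⟨l, fun _ => hl⟩
    · exact ⟨0, fun h => absurd h ht⟩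
  have e2 : ∀ t, ∃ l, 0 ≤ t → Tendsto (fun N => (eul W (tau N) x ξ (idx N t)).2) (hyperfilter ℕ) (𝓝 l) := by
    intro t
    by_cases ht : 0 ≤ t
    · obtain ⟨l, hl⟩ := ultra_lim (fun N => (eul_bd W hW (tau_pos N).le x ξ (idx_le (N := N) ht)).1)
      exact ⟨l, fun _ => hl⟩
    · exact ⟨0, fun h => absurd h ht⟩
  choose X hX using e1
  choose Ξ hΞ using e2
  refine ⟨X, Ξ, hX, hΞ, ?_, ?_, ?_⟩
  · have := hX 0 le_rfl
    simp only [idx, zero_mul, Nat.floor_zero, eul] at this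
    exact tendsto_nhds_unique this tendsto_const_nhds
  · have := hΞ 0 le_rfl
    simp only [idx, zero_mul, Nat.floor_zero, eul] at this
    exact tendsto_nhds_unique this tendsto_const_nhds
  · intro s t hs hst
    have ht := hs.trans hst
    have hd := (idx_tendsto ht).sub (idx_tendsto hs)
    constructor
    · exact le_of_tendsto_of_tendsto' ((hΞ t ht).sub (hΞ s hs)).norm (hd.mul_const R)
        (fun N => (eul_est' W hW x ξ (idx_mono (N := N) hst)).1)
    · exact le_of_tendsto_of_tendsto' (((hX t ht).sub (hX s hs)).sub (hd.smul (hΞ s hs))).norm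
        ((hd.pow 2).mul_const R)
        (fun N => (eul_est' W hW x ξ (idx_mono (N := N) hst)).2)

end


namespace Dat

variable {H : Type*} [NormedAddCommGroup H] [InnerProductSpace ℝ H] [FiniteDimensional ℝ H]
  {Ω Ωs : Set H} {c : H → H → ℝ} {P q : H → H → H} {A M : H → H → H →L[ℝ] H}

/-- mean value along an Euler step -/
lemma step_x (D : Dat Ω Ωs c P q A M) {x y₀ ξ V y : H} {τ : ℝ} (hτ : 0 < τ) (hy0 : y₀ ∈ Ωs) (hy : y ∈ Ωs)
    (hx : ∀ t ∈ Icc 0 τ, x + t • ξ ∈ Ω) :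
    ∃ t ∈ Ioo 0 τ, inner ℝ (P (x + τ • ξ) y - P (x + τ • ξ) y₀) (ξ + τ • V) =
      inner ℝ (P x y - P x y₀) ξ + τ * DD P A y₀ x ξ V y t := by
  set g : ℝ → ℝ := fun t => inner ℝ (P (x + t • ξ) y - P (x + t • ξ) y₀) (ξ + t • V) with hg
  have hd : ∀ t ∈ Icc 0 τ, HasDerivAt g (DD P A y₀ x ξ V y t) t := by
    intro t ht
    have h0 : HasDerivAt (fun t : ℝ => x + t • ξ) ξ t := by
      simpa using ((hasDerivAt_id t).smul_const ξ).const_add x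
    have h0' : HasDerivAt (fun t : ℝ => ξ + t • V) V t := by
      simpa using ((hasDerivAt_id t).smul_const V).const_add ξ
    have h1 := (D.Px (hx t ht) hy).comp_hasDerivAt t h0
    have h2 := (D.Px (hx t ht) hy0).comp_hasDerivAt t h0
    have h3 := (h1.sub h2).inner ℝ h0'
    refine h3.congr_deriv ?_
    simp [DD]
    ring
  obtain ⟨t, ht, he⟩ := exists_hasDerivAt_eq_slope g _ hτ
    (fun t ht => (hd t ht).continuousAt.continuousWithinAt) (fun t ht => hd t ⟨ht.1.le, ht.2.le⟩)
  refine ⟨t, ht, ?_⟩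
  rw [he]
  have : g 0 = inner ℝ (P x y - P x y₀) ξ := by simp [hg]
  rw [this, sub_zero, mul_div_cancel₀ _ hτ.ne']
  simp only [hg]; ring

lemma step_y (D : Dat Ω Ωs c P q A M) {x y₀ ξ y e : H} {s c0 : ℝ} (hs : 0 < s) (hxΩ : x ∈ Ω)
    (hy : ∀ t ∈ Icc 0 s, y + t • e ∈ Ωs) (hc : ∀ t ∈ Icc 0 s, c0 ≤ inner ℝ (M x (y + t • e) e) ξ) :
    inner ℝ (P x y - P x y₀) ξ + c0 * s ≤ inner ℝ (P x (y + s • e) - P x y₀) ξ := by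
  set g : ℝ → ℝ := fun t => inner ℝ (P x (y + t • e) - P x y₀) ξ with hg
  have hd : ∀ t ∈ Icc 0 s, HasDerivAt g (inner ℝ (M x (y + t • e) e) ξ) t := by
    intro t ht
    have h0 : HasDerivAt (fun t : ℝ => y + t • e) e t := by
      simpa using ((hasDerivAt_id t).smul_const e).const_add y
    have h1 := (D.Py hxΩ (hy t ht)).comp_hasDerivAt t h0
    have h3 := (h1.sub_const (P x y₀)).inner ℝ (hasDerivAt_const t ξ)
    refine h3.congr_deriv ?_
    simp
  obtain ⟨t, ht, he⟩ := exists_hasDerivAt_eq_slope g _ hs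
    (fun t ht => (hd t ht).continuousAt.continuousWithinAt) (fun t ht => hd t ⟨ht.1.le, ht.2.le⟩)
  have h1 := hc t ⟨ht.1.le, ht.2.le⟩
  rw [he, le_div_iff₀ (by linarith)] at h1
  have : g 0 = inner ℝ (P x y - P x y₀) ξ := by simp [hg]
  rw [this] at h1
  simp only [hg] at h1
  linarith

set_option maxHeartbeats 1000000 in
lemma mono_disc (D : Dat Ω Ωs c P q A M) {x ξ y₀ ys : H} (hx : x ∈ Ω) (hξ : ξ ≠ 0) (hy0 : y₀ ∈ Ωs)
    (hys : ys ∈ Ωs) {W : H → H → H} {R : ℝ} (hW : ∀ x ξ, ‖W x ξ‖ ≤ R)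
    (hA : ∀ᶠ z : H × H in 𝓝 (x, ξ), Adm Ωs P A y₀ z.1 z.2 (W z.1 z.2)) :
    ∃ T > (0:ℝ), ∃ r > (0:ℝ), ∃ e : H, ∃ κ0 > (0:ℝ), ∀ y ∈ Metric.ball ys r, 0 ≤ inner ℝ (P x y - P x y₀) ξ →
      ∀ κ > (0:ℝ), κ < κ0 → ∃ τ0 > (0:ℝ), ∀ τ > (0:ℝ), τ < τ0 → ∀ k : ℕ, k * τ ≤ T →
        0 ≤ inner ℝ (P (eul W τ x ξ k).1 (y + (κ * (k * τ)) • e) - P (eul W τ x ξ k).1 y₀)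
          (eul W τ x ξ k).2 := by
  have hR : 0 ≤ R := (norm_nonneg _).trans (hW 0 0)
  obtain ⟨e, he⟩ := (D.bij x hx ys hys).2 ξ
  set c0 := ‖ξ‖ ^ 2 / 2 with hc0
  have hξp : 0 < ‖ξ‖ := norm_pos_iff.mpr hξ
  have c0p : 0 < c0 := by positivity
  have hcM : ContinuousAt (fun w : (H × H) × H => inner ℝ (M w.1.1 w.2 e) w.1.2) ((x, ξ), ys) := by
    have : ContinuousAt (fun w : (H × H) × H => M w.1.1 w.2) ((x, ξ), ys) :=
      D.cM_comp (by fun_prop) (by fun_prop) hx hys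
    exact (this.clm_apply (by fun_prop)).inner (𝕜 := ℝ) (by fun_prop)
  have ev1 := hcM.eventually (lt_mem_nhds (show c0 < inner ℝ (M x ys e) ξ by
    rw [he, real_inner_self_eq_norm_sq]; linarith))
  have ev2 : ∀ᶠ w : (H × H) × H in 𝓝 ((x, ξ), ys), Adm Ωs P A y₀ w.1.1 w.1.2 (W w.1.1 w.1.2) :=
    (continuous_fst.continuousAt (x := ((x, ξ), ys))).eventually hA
  have ev3 : ∀ᶠ w : (H × H) × H in 𝓝 ((x, ξ), ys), w.1.1 ∈ Ω :=
    (by fun_prop : ContinuousAt (fun w : (H × H) × H => w.1.1) ((x, ξ), ys)).eventually (D.oΩ.mem_nhds hx)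
  have ev4 : ∀ᶠ w : (H × H) × H in 𝓝 ((x, ξ), ys), w.1.2 ≠ 0 :=
    (by fun_prop : ContinuousAt (fun w : (H × H) × H => w.1.2) ((x, ξ), ys)).eventually_ne hξ
  have ev5 : ∀ᶠ w : (H × H) × H in 𝓝 ((x, ξ), ys), w.2 ∈ Ωs :=
    (by fun_prop : ContinuousAt (fun w : (H × H) × H => w.2) ((x, ξ), ys)).eventually (D.oS.mem_nhds hys)
  obtain ⟨ρ', hρ', hall⟩ := Metric.eventually_nhds_iff.mp (ev1.and (ev2.and (ev3.and (ev4.and ev5))))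
  set ρ := ρ' / 2 with hρdef
  have hρ : 0 < ρ := by positivity
  have hall : ∀ a b z : H, ‖a - x‖ ≤ ρ → ‖b - ξ‖ ≤ ρ → ‖z - ys‖ ≤ ρ →
      c0 ≤ inner ℝ (M a z e) b ∧ Adm Ωs P A y₀ a b (W a b) ∧ a ∈ Ω ∧ b ≠ 0 ∧ z ∈ Ωs := by
    intro a b z ha hb hz
    have := hall (y := ((a, b), z)) (by
      rw [Prod.dist_eq, Prod.dist_eq, max_lt_iff, max_lt_iff]
      simp only [dist_eq_norm]
      refine ⟨⟨?_, ?_⟩, ?_⟩ <;> linarith)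
    exact ⟨this.1.le, this.2⟩
  have h0x : ‖x - x‖ ≤ ρ := by simp [hρ.le]
  have h0ξ : ‖ξ - ξ‖ ≤ ρ := by simp [hρ.le]
  have h0y : ‖ys - ys‖ ≤ ρ := by simp [hρ.le]
  have hinx : ∀ a, ‖a - x‖ ≤ ρ → a ∈ Ω := fun a ha => (hall a ξ ys ha h0ξ h0y).2.2.1
  have hiny : ∀ a, ‖a - ys‖ ≤ ρ → a ∈ Ωs := fun a ha => (hall x ξ a h0x h0ξ ha).2.2.2.2
  set τ1 := ρ / 2 / (‖ξ‖ + ρ) with hτ1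
  have hτ1p : 0 < τ1 := by positivity
  have hseg : ∀ a ∈ Metric.closedBall x (ρ / 2), ∀ b ∈ Metric.closedBall ξ (ρ / 2), ∀ τ ∈ Icc 0 τ1,
      a + τ • b ∈ Ω := by
    intro a ha b hb τ hτ
    rw [mem_closedBall_iff_norm] at ha hb
    apply hinx
    have hb' : ‖b‖ ≤ ‖ξ‖ + ρ := by
      have := norm_add_le (b - ξ) ξ
      rw [sub_add_cancel] at this; linarith
    calc ‖a + τ • b - x‖ = ‖(a - x) + τ • b‖ := by congr 1; abel
      _ ≤ ‖a - x‖ + ‖τ • b‖ := norm_add_le _ _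
      _ ≤ ρ / 2 + τ1 * (‖ξ‖ + ρ) := by
        rw [norm_smul, Real.norm_eq_abs, abs_of_nonneg hτ.1]
        have := hτ.2
        gcongr
      _ = ρ := by rw [hτ1]; field_simp; ring
  obtain ⟨⟨C, hC⟩, hunif⟩ := D.unif hy0 (isCompact_closedBall x (ρ / 2)) (isCompact_closedBall ξ (ρ / 2))
    (isCompact_closedBall (0:H) R) (isCompact_closedBall ys ρ)
    (fun a ha => hinx a (by rw [mem_closedBall_iff_norm] at ha; linarith))
    (fun b hb => (hall x b ys h0x (by rw [mem_closedBall_iff_norm] at hb; linarith) h0y).2.2.2.1)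
    (fun a ha => hiny a (by rwa [mem_closedBall_iff_norm] at ha)) hseg
  set T := min 1 (ρ / 2 / (‖ξ‖ + R + 1)) with hT
  have hTp : 0 < T := by positivity
  have hT1 : T ≤ 1 := min_le_left _ _
  have hT2 : T * (‖ξ‖ + R + 1) ≤ ρ / 2 := by
    rw [← le_div_iff₀ (by positivity)]; exact min_le_right _ _
  refine ⟨T, hTp, ρ / 2, by positivity, e, ρ / 2 / (‖e‖ + 1), by positivity, ?_⟩
  intro y hyb hF κ hκ hκ0
  rw [mem_ball_iff_norm] at hyb
  have hκe : κ * (‖e‖ + 1) ≤ ρ / 2 := by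
    rw [← le_div_iff₀ (by positivity)]; exact hκ0.le
  obtain ⟨δ, hδ, hδu⟩ := hunif (c0 * κ) (by positivity)
  have hCC : 0 < |C| + 1 := by positivity
  refine ⟨min τ1 (min δ (δ / (|C| + 1))), by positivity, ?_⟩
  intro τ hτ hττ
  have ha1 : τ ≤ τ1 := hττ.le.trans (min_le_left _ _)
  have ha2 : τ ≤ δ := hττ.le.trans ((min_le_right _ _).trans (min_le_left _ _))
  have ha3 : τ * (|C| + 1) ≤ δ := by
    rw [← le_div_iff₀ hCC]; exact hττ.le.trans ((min_le_right _ _).trans (min_le_right _ _))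
  have hyin : ∀ s, 0 ≤ s → s ≤ T → ‖y + (κ * s) • e - ys‖ ≤ ρ := by
    intro s hs hsT
    calc ‖y + (κ * s) • e - ys‖ = ‖(y - ys) + (κ * s) • e‖ := by congr 1; abel
      _ ≤ ‖y - ys‖ + ‖(κ * s) • e‖ := norm_add_le _ _
      _ ≤ ρ / 2 + (κ * 1) * ‖e‖ := by
        rw [norm_smul, Real.norm_eq_abs, abs_of_nonneg (by positivity)]
        have : s ≤ 1 := hsT.trans hT1
        gcongr
      _ ≤ ρ := by nlinarith
  have hbd : ∀ k : ℕ, k * τ ≤ T → ‖(eul W τ x ξ k).1 - x‖ ≤ ρ / 2 ∧ ‖(eul W τ x ξ k).2 - ξ‖ ≤ ρ / 2 := by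
    intro k hk
    have := eul_bd W hW hτ.le x ξ hk
    have h3 : T ^ 2 * R ≤ T * R := by
      have : T ^ 2 ≤ T := by nlinarith
      gcongr
    have h4 : 0 ≤ T * ‖ξ‖ := by positivity
    have h5 : 0 ≤ T * R := by positivity
    constructor
    · nlinarith [this.2]
    · nlinarith [this.1]
  intro k
  induction k with
  | zero =>
    intro _
    simpa [eul] using hF
  | succ k ih =>
    intro hk1
    have hk : (k : ℝ) * τ ≤ T := by
      push_cast at hk1; nlinarith
    have ih := ih hk
    have hk1' : (k : ℝ) * τ + τ ≤ T := by push_cast at hk1; linarith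
    obtain ⟨b1, b2⟩ := hbd k hk
    obtain ⟨b3, b4⟩ := hbd (k + 1) hk1
    set z := eul W τ x ξ k with hz
    set yk := y + (κ * (k * τ)) • e with hyk
    have hyk0 : ‖yk - ys‖ ≤ ρ := hyin (k * τ) (by positivity) hk
    have hz1 : z.1 ∈ Metric.closedBall x (ρ / 2) := by rwa [mem_closedBall_iff_norm]
    have hz2 : z.2 ∈ Metric.closedBall ξ (ρ / 2) := by rwa [mem_closedBall_iff_norm]
    have hWm : W z.1 z.2 ∈ Metric.closedBall (0:H) R := by simpa using hW z.1 z.2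
    have hykm : yk ∈ Metric.closedBall ys ρ := by rwa [mem_closedBall_iff_norm]
    obtain ⟨t, ht, hst⟩ := D.step_x (V := W z.1 z.2) (x := z.1) (ξ := z.2) hτ hy0 (hiny _ hyk0)
      (fun t ht => hseg z.1 hz1 z.2 hz2 t ⟨ht.1, ht.2.trans ha1⟩)
    have htm : t ∈ Icc 0 τ1 := ⟨ht.1.le, ht.2.le.trans ha1⟩
    have hadm := (hall z.1 z.2 ys (by linarith) (by linarith) h0y).2.1
    have hlow : -(c0 * κ * τ) ≤ inner ℝ (P (z.1 + τ • z.2) yk - P (z.1 + τ • z.2) y₀) (z.2 + τ • W z.1 z.2) := by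
      rw [hst]
      by_cases hδ' : inner ℝ (P z.1 yk - P z.1 y₀) z.2 ≤ δ
      · have := hδu z.1 hz1 z.2 hz2 _ hWm yk hykm t htm hadm (by rwa [abs_of_nonneg ih]) (ht.2.le.trans ha2)
        have h8 := mul_le_mul_of_nonneg_left this hτ.le
        linarith
      · have := hC z.1 hz1 z.2 hz2 _ hWm yk hykm t htm
        have h6 := (abs_le.mp (this.trans (le_abs_self C))).1
        have h7 : 0 ≤ c0 * κ * τ := by positivity
        push Not at hδ'
        have h8 := mul_le_mul_of_nonneg_left h6 hτ.le
        linarith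
    have hstep := D.step_y (x := z.1 + τ • z.2) (y₀ := y₀) (ξ := z.2 + τ • W z.1 z.2) (y := yk) (e := e)
      (s := κ * τ) (c0 := c0) (by positivity) (hseg z.1 hz1 z.2 hz2 τ ⟨hτ.le, ha1⟩)
    have hyt : ∀ t ∈ Icc 0 (κ * τ), ‖yk + t • e - ys‖ ≤ ρ := by
      intro t ht
      have := hyin (k * τ + t / κ) (by have := ht.1; positivity) (by
        have : t / κ ≤ τ := by rw [div_le_iff₀ hκ]; linarith [ht.2]
        linarith)
      have e1 : yk + t • e = y + (κ * (k * τ + t / κ)) • e := by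
        rw [hyk, add_assoc, ← add_smul]; congr 2; field_simp
      rwa [e1]
    have hstep := hstep (fun t ht => hiny _ (hyt t ht)) (fun t ht =>
      (hall (z.1 + τ • z.2) (z.2 + τ • W z.1 z.2) _ (by
        have : (eul W τ x ξ (k+1)).1 = z.1 + τ • z.2 := rfl
        rw [← this]; linarith) (by
        have : (eul W τ x ξ (k+1)).2 = z.2 + τ • W z.1 z.2 := rfl
        rw [← this]; linarith) (hyt t ht)).1)
    have e2 : y + (κ * (((k + 1 : ℕ) : ℝ) * τ)) • e = yk + (κ * τ) • e := by
      rw [hyk, add_assoc, ← add_smul]; congr 2; push_cast; ring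
    rw [e2]
    change 0 ≤ inner ℝ (P (z.1 + τ • z.2) (yk + (κ * τ) • e) - P (z.1 + τ • z.2) y₀) (z.2 + τ • W z.1 z.2)
    linarith

lemma mono_lim (D : Dat Ω Ωs c P q A M) {x ξ y₀ ys : H} (hx : x ∈ Ω) (hξ : ξ ≠ 0) (hy0 : y₀ ∈ Ωs)
    (hys : ys ∈ Ωs) {W : H → H → H} {R : ℝ} (hW : ∀ x ξ, ‖W x ξ‖ ≤ R)
    (hA : ∀ᶠ z : H × H in 𝓝 (x, ξ), Adm Ωs P A y₀ z.1 z.2 (W z.1 z.2)) {X Ξ : ℝ → H}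
    (hX : ∀ t, 0 ≤ t → Tendsto (fun N => (eul W (tau N) x ξ (idx N t)).1) (hyperfilter ℕ) (𝓝 (X t)))
    (hΞ : ∀ t, 0 ≤ t → Tendsto (fun N => (eul W (tau N) x ξ (idx N t)).2) (hyperfilter ℕ) (𝓝 (Ξ t))) :
    ∃ T > (0:ℝ), ∃ r > (0:ℝ), ∀ y ∈ Metric.ball ys r, y ∈ Ωs → 0 ≤ inner ℝ (P x y - P x y₀) ξ →
      ∀ t, 0 ≤ t → t ≤ T → X t ∈ Ω → 0 ≤ inner ℝ (P (X t) y - P (X t) y₀) (Ξ t) := by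
  obtain ⟨T, hT, r, hr, e, κ0, hκ0, hm⟩ := D.mono_disc hx hξ hy0 hys hW hA
  refine ⟨T, hT, r, hr, fun y hyb hyS hF t ht0 htT hXt => ?_⟩
  have hcy : Tendsto (fun κ : ℝ => y + (κ * t) • e) (𝓝 0) (𝓝 y) := by
    have : Continuous (fun κ : ℝ => y + (κ * t) • e) := by fun_prop
    simpa using this.tendsto 0
  have hin : ∀ᶠ κ : ℝ in 𝓝 0, y + (κ * t) • e ∈ Ωs := hcy.eventually (D.oS.mem_nhds hyS)
  have step1 : ∀ κ > (0:ℝ), κ < κ0 → y + (κ * t) • e ∈ Ωs →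
      0 ≤ inner ℝ (P (X t) (y + (κ * t) • e) - P (X t) y₀) (Ξ t) := by
    intro κ hκ hκκ hyin
    obtain ⟨τ0, hτ0, hk⟩ := hm y hyb hF κ hκ hκκ
    have hc : ContinuousAt (fun w : H × H × H => inner ℝ (P w.1 w.2.2 - P w.1 y₀) w.2.1)
        (X t, Ξ t, y + (κ * t) • e) := by
      have a1 : ContinuousAt (fun w : H × H × H => P w.1 w.2.2) (X t, Ξ t, y + (κ * t) • e) :=
        D.cP_comp (by fun_prop) (by fun_prop) hXt hyin
      have a2 : ContinuousAt (fun w : H × H × H => P w.1 y₀) (X t, Ξ t, y + (κ * t) • e) :=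
        D.cP_comp (by fun_prop) (by fun_prop) hXt hy0
      exact (a1.sub a2).inner (𝕜 := ℝ) (by fun_prop)
    have hl : Tendsto (fun N => y + (κ * (idx N t * tau N)) • e) (hyperfilter ℕ) (𝓝 (y + (κ * t) • e)) :=
      (((idx_tendsto ht0).const_mul κ).smul_const e).const_add y
    have hlim := hc.tendsto.comp ((hX t ht0).prodMk_nhds ((hΞ t ht0).prodMk_nhds hl))
    refine ge_of_tendsto hlim ?_
    filter_upwards [tau_tendsto.eventually (gt_mem_nhds hτ0)] with N hN
    exact hk (tau N) (tau_pos N) hN (idx N t) ((idx_le ht0).trans htT)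
  have hc2 : ContinuousAt (fun w : H => inner ℝ (P (X t) w - P (X t) y₀) (Ξ t)) y := by
    have a1 : ContinuousAt (fun w : H => P (X t) w) y :=
        D.cP_comp (by fun_prop) (by fun_prop) hXt hyS
    exact (a1.sub continuousAt_const).inner (𝕜 := ℝ) (by fun_prop)
  refine ge_of_tendsto (x := 𝓝[>] (0:ℝ)) ((hc2.tendsto.comp hcy).mono_left nhdsWithin_le_nhds) ?_
  filter_upwards [self_mem_nhdsWithin, nhdsWithin_le_nhds (gt_mem_nhds hκ0), nhdsWithin_le_nhds hin]
    with κ h1 h2 h3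
  exact step1 κ h1 h2 h3

end Dat


section
variable {H : Type*} [NormedAddCommGroup H] [InnerProductSpace ℝ H]

lemma ray_of_halfspace {a b : H} (ha : a ≠ 0) (hb : b ≠ 0)
    (h : ∀ v, 0 < inner ℝ v a → 0 ≤ inner ℝ v b) : ∃ l : ℝ, 0 < l ∧ b = l • a := by
  have haa : 0 < inner ℝ a a := by
    rw [real_inner_self_eq_norm_sq]; have := norm_pos_iff.mpr ha; positivity
  set l := inner ℝ a b / inner ℝ a a with hl
  set w := b - l • a with hw
  have hwa : inner ℝ w a = 0 := by
    rw [hw, inner_sub_left, inner_smul_left, real_inner_comm, hl]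
    simp only [conj_trivial]; field_simp; ring
  have hwb : inner ℝ w b = inner ℝ w w := by
    have : b = w + l • a := by rw [hw]; abel
    nth_rewrite 1 [this]
    rw [inner_add_right, inner_smul_right, hwa]; ring
  have hw0 : w = 0 := by
    by_contra hne
    have hww : 0 < inner ℝ w w := by
      rw [real_inner_self_eq_norm_sq]; have := norm_pos_iff.mpr hne; positivity
    have := h (a - ((inner ℝ a b + 1) / inner ℝ w w) • w) (by
      rw [inner_sub_left, inner_smul_left, hwa]; simpa using haa)
    rw [inner_sub_left, inner_smul_left, hwb] at this
    simp only [conj_trivial] at this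
    rw [div_mul_cancel₀ _ hww.ne'] at this
    linarith
  have hbl : b = l • a := by
    rw [hw, sub_eq_zero] at hw0; exact hw0
  refine ⟨l, ?_, hbl⟩
  have h1 : 0 ≤ l := div_nonneg (h a haa) haa.le
  rcases h1.eq_or_lt with h2 | h2
  · rw [← h2, zero_smul] at hbl; exact absurd hbl hb
  · exact h2

variable [FiniteDimensional ℝ H]

lemma adj_inj {L : H →L[ℝ] H} (h : Function.Bijective L) :
    Function.Injective (ContinuousLinearMap.adjoint L) := by
  intro a b hab
  obtain ⟨v, hv⟩ := h.2 (a - b)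
  have : inner ℝ (L v) (a - b) = 0 := by
    rw [← ContinuousLinearMap.adjoint_inner_right, map_sub, hab, sub_self, inner_zero_right]
  rw [hv] at this
  exact sub_eq_zero.mp (inner_self_eq_zero.mp this)

end

namespace Dat

variable {H : Type*} [NormedAddCommGroup H] [InnerProductSpace ℝ H] [FiniteDimensional ℝ H]
  {Ω Ωs : Set H} {c : H → H → ℝ} {P q : H → H → H} {A M : H → H → H →L[ℝ] H}

lemma dF (D : Dat Ω Ωs c P q A M) {x y₀ : H} (hx : x ∈ Ω) (hy0 : y₀ ∈ Ωs) (ξ v : H) :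
    Tendsto (fun r : ℝ => r⁻¹ * inner ℝ (P x (y₀ + r • v) - P x y₀) ξ) (𝓝[>] 0)
      (𝓝 (inner ℝ v (ContinuousLinearMap.adjoint (M x y₀) ξ))) := by
  have h0 : HasDerivAt (fun t : ℝ => y₀ + t • v) v 0 := by
    simpa using ((hasDerivAt_id (0:ℝ)).smul_const v).const_add y₀
  have hp : HasFDerivAt (fun y => P x y) (M x y₀) (y₀ + (0:ℝ) • v) := by
    rw [zero_smul, add_zero]; exact D.Py hx hy0
  have h1 := hp.comp_hasDerivAt 0 h0
  have h2 := (h1.sub_const (P x y₀)).inner ℝ (hasDerivAt_const 0 ξ)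
  have h3 := h2.tendsto_slope_zero_right
  simp only [Function.comp_def, zero_add, zero_smul, add_zero, sub_self, inner_zero_left, sub_zero,
    inner_zero_right, smul_eq_mul] at h3
  rw [ContinuousLinearMap.adjoint_inner_right]
  exact h3

set_option maxHeartbeats 1000000 in
lemma localL (D : Dat Ω Ωs c P q A M) {x ξ y₀ y₁ : H} (hx : x ∈ Ω) (hξ : ξ ≠ 0) (hy0 : y₀ ∈ Ωs)
    (hy1 : y₁ ∈ Ωs) (hF : 0 ≤ inner ℝ (P x y₁ - P x y₀) ξ) :
    ∃ σ > (0:ℝ), ∀ s, 0 ≤ s → s ≤ σ → ∀ x' ∈ Ω,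
      q x' y₀ = q x y₀ + s • ContinuousLinearMap.adjoint (M x y₀) ξ →
      ∀ ξ', ContinuousLinearMap.adjoint (M x' y₀) ξ' = ContinuousLinearMap.adjoint (M x y₀) ξ →
        0 ≤ inner ℝ (P x' y₁ - P x' y₀) ξ' := by
  classical
  obtain ⟨R, hR, hRe⟩ := D.adm_bound hx hy0 hξ
  set W : H → H → H := fun a b =>
    if h : ∃ V, ‖V‖ ≤ R ∧ Adm Ωs P A y₀ a b V then h.choose else 0 with hWdef
  have hW : ∀ a b, ‖W a b‖ ≤ R := by
    intro a b
    simp only [hWdef]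
    split_ifs with h
    · exact h.choose_spec.1
    · simpa using hR.le
  have hA : ∀ᶠ z : H × H in 𝓝 (x, ξ), Adm Ωs P A y₀ z.1 z.2 (W z.1 z.2) := by
    filter_upwards [hRe] with z hz
    simp only [hWdef]
    rw [dif_pos hz]
    exact hz.choose_spec.2
  obtain ⟨X, Ξ, hX, hΞ, hX0, hΞ0, hest⟩ := euler_lim W hW x ξ
  obtain ⟨T0, hT0, r0, hr0, hm0⟩ := D.mono_lim hx hξ hy0 hy0 hW hA hX hΞ
  obtain ⟨T1, hT1, r1, hr1, hm1⟩ := D.mono_lim hx hξ hy0 hy1 hW hA hX hΞ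
  set n₀ := ContinuousLinearMap.adjoint (M x y₀) ξ with hn₀
  have hn₀0 : n₀ ≠ 0 := by
    intro h
    exact hξ (adj_inj (D.bij x hx y₀ hy0) (by rw [map_zero]; exact h))
  set L := ‖ξ‖ + 2 * R with hL
  have hξp : 0 < ‖ξ‖ := norm_pos_iff.mpr hξ
  have hLp : 0 < L := by positivity
  have hLip : ∀ s t, 0 ≤ s → s ≤ t → t ≤ 1 → ‖X t - X s‖ ≤ L * (t - s) := by
    intro s t hs hst ht1
    have h1 := (hest 0 s le_rfl hs).1
    rw [hΞ0, sub_zero] at h1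
    have h2 : ‖Ξ s‖ ≤ ‖ξ‖ + R := by
      have := norm_add_le (Ξ s - ξ) ξ
      rw [sub_add_cancel] at this
      nlinarith
    have h0 : 0 ≤ t - s := by linarith
    calc ‖X t - X s‖ = ‖(X t - X s - (t - s) • Ξ s) + (t - s) • Ξ s‖ := by congr 1; abel
      _ ≤ ‖X t - X s - (t - s) • Ξ s‖ + ‖(t - s) • Ξ s‖ := norm_add_le _ _
      _ ≤ (t - s) ^ 2 * R + (t - s) * (‖ξ‖ + R) := by
        rw [norm_smul, Real.norm_eq_abs, abs_of_nonneg h0]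
        have := (hest s t hs hst).2
        gcongr
      _ ≤ (t - s) * R + (t - s) * (‖ξ‖ + R) := by
        have : (t - s) ^ 2 ≤ t - s := by nlinarith
        gcongr
      _ = L * (t - s) := by rw [hL]; ring
  have hder : ∀ s, 0 ≤ s → HasDerivWithinAt X (Ξ s) (Ici s) s := by
    intro s hs
    rw [hasDerivWithinAt_iff_isLittleO]
    have hO : (fun t => X t - X s - (t - s) • Ξ s) =O[𝓝[Ici s] s] (fun t => (t - s) ^ 2) := by
      refine Asymptotics.IsBigO.of_bound R ?_
      filter_upwards [self_mem_nhdsWithin] with t ht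
      have := (hest s t hs ht).2
      rw [Real.norm_eq_abs, abs_of_nonneg (sq_nonneg _)]
      linarith
    refine hO.trans_isLittleO ?_
    have h2 : (fun t : ℝ => (t - s) ^ 2) =o[𝓝 s] (fun t => t - s) := by
      have := Asymptotics.isLittleO_pow_id (𝕜 := ℝ) (n := 2) (by norm_num)
      have ht : Tendsto (fun t : ℝ => t - s) (𝓝 s) (𝓝 0) := by
        have : Continuous (fun t : ℝ => t - s) := by fun_prop
        simpa using this.tendsto s
      exact this.comp_tendsto ht
    exact h2.mono nhdsWithin_le_nhds
  obtain ⟨ρ, hρ, hρΩ⟩ := Metric.isOpen_iff.mp D.oΩ x hx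
  set T := min (min 1 (min T0 T1)) (min (ρ / (2 * L)) (‖ξ‖ / (2 * R))) with hT
  have hTp : 0 < T := by positivity
  have t1 : T ≤ 1 := (min_le_left _ _).trans (min_le_left _ _)
  have t2 : T ≤ T0 := (min_le_left _ _).trans ((min_le_right _ _).trans (min_le_left _ _))
  have t3 : T ≤ T1 := (min_le_left _ _).trans ((min_le_right _ _).trans (min_le_right _ _))
  have t4 : T * (2 * L) ≤ ρ := by
    rw [← le_div_iff₀ (by positivity)]; exact (min_le_right _ _).trans (min_le_left _ _)
  have t5 : T * (2 * R) ≤ ‖ξ‖ := by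
    rw [← le_div_iff₀ (by positivity)]; exact (min_le_right _ _).trans (min_le_right _ _)
  have hXΩ : ∀ t, 0 ≤ t → t ≤ T → X t ∈ Ω := by
    intro t h0 h1
    apply hρΩ
    rw [mem_ball_iff_norm]
    have := hLip 0 t le_rfl h0 (h1.trans t1)
    rw [hX0, sub_zero] at this
    nlinarith
  have hΞn : ∀ t, 0 ≤ t → t ≤ T → Ξ t ≠ 0 := by
    intro t h0 h1 hz
    have := (hest 0 t le_rfl h0).1
    rw [hΞ0, hz, zero_sub, norm_neg, sub_zero] at this
    nlinarith
  have hray : ∀ t, 0 ≤ t → t ≤ T → ∃ l : ℝ, 0 < l ∧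
      ContinuousLinearMap.adjoint (M (X t) y₀) (Ξ t) = l • n₀ := by
    intro t h0 h1
    have hXt := hXΩ t h0 h1
    apply ray_of_halfspace hn₀0
    · intro h
      exact hΞn t h0 h1 (adj_inj (D.bij _ hXt y₀ hy0) (by rw [map_zero]; exact h))
    · intro v hv
      have e1 := (D.dF hx hy0 ξ v).eventually (lt_mem_nhds hv)
      have hcy : Tendsto (fun r : ℝ => y₀ + r • v) (𝓝[>] 0) (𝓝 y₀) := by
        have : Continuous (fun r : ℝ => y₀ + r • v) := by fun_prop
        have := this.tendsto 0
        simp only [zero_smul, add_zero] at this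
        exact this.mono_left nhdsWithin_le_nhds
      have e2 := hcy.eventually (D.oS.mem_nhds hy0)
      have e3 := hcy.eventually (Metric.ball_mem_nhds y₀ hr0)
      refine ge_of_tendsto (D.dF hXt hy0 (Ξ t) v) ?_
      filter_upwards [e1, e2, e3, self_mem_nhdsWithin] with r f1 f2 f3 f4
      have f4 : (0:ℝ) < r := f4
      have f5 : 0 ≤ inner ℝ (P x (y₀ + r • v) - P x y₀) ξ := by
        by_contra hcon
        push Not at hcon
        have := mul_neg_of_pos_of_neg (inv_pos.mpr f4) hcon
        linarith
      have := hm0 _ f3 f2 f5 t h0 (h1.trans t2) hXt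
      positivity
  have hXc : ContinuousOn X (Icc 0 T) := by
    have : LipschitzOnWith ⟨L, hLp.le⟩ X (Icc 0 T) := by
      apply LipschitzOnWith.of_dist_le_mul
      intro a ha b hb
      change dist (X a) (X b) ≤ L * dist a b
      rcases le_total a b with hab | hab
      · rw [dist_comm, dist_comm a b, dist_eq_norm, Real.dist_eq, abs_of_nonneg (by linarith)]
        exact hLip a b ha.1 hab (hb.2.trans t1)
      · rw [dist_eq_norm, Real.dist_eq, abs_of_nonneg (by linarith)]
        exact hLip b a hb.1 hab (ha.2.trans t1)
    exact this.continuousOn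
  set u : ℝ → H := fun t => q (X t) y₀ - q x y₀ with hu
  have huc : ContinuousOn u (Icc 0 T) := by
    intro t ht
    have := (D.q' (X t) (hXΩ t ht.1 ht.2) y₀ hy0).hasFDerivAt.continuousAt
    exact (this.comp_continuousWithinAt (hXc t ht)).sub continuousWithinAt_const
  have hud : ∀ t ∈ Icc 0 T, HasDerivWithinAt u (ContinuousLinearMap.adjoint (M (X t) y₀) (Ξ t)) (Ici t) t := by
    intro t ht
    have h1 := (D.q' (X t) (hXΩ t ht.1 ht.2) y₀ hy0).hasFDerivAt
    have h2 := h1.comp_hasDerivWithinAt t (hder t ht.1)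
    exact h2.sub_const _
  set sc : ℝ → ℝ := fun t => inner ℝ n₀ (u t) / inner ℝ n₀ n₀ with hsc
  have hscc : ContinuousOn sc (Icc 0 T) := (continuousOn_const.inner (𝕜 := ℝ) huc).div_const _
  have hscd : ∀ t ∈ Icc 0 T, HasDerivWithinAt sc
      (inner ℝ n₀ (ContinuousLinearMap.adjoint (M (X t) y₀) (Ξ t)) / inner ℝ n₀ n₀) (Ici t) t := by
    intro t ht
    have := ((hasDerivWithinAt_const t (Ici t) n₀).inner ℝ (hud t ht)).div_const (inner ℝ n₀ n₀)
    refine this.congr_deriv ?_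
    rw [inner_zero_left, add_zero]
  have hnn : inner ℝ n₀ n₀ ≠ 0 := by simpa using hn₀0
  have hu0 : u 0 = 0 := by simp [hu, hX0]
  have hsc0 : sc 0 = 0 := by simp [hsc, hu0]
  have huline : ∀ t ∈ Icc 0 T, u t = sc t • n₀ := by
    have hz := constant_of_has_deriv_right_zero (f := fun t => u t - sc t • n₀) (a := 0) (b := T)
      (huc.sub (hscc.smul continuousOn_const)) (by
        intro t ht
        have ht' : t ∈ Icc 0 T := ⟨ht.1, ht.2.le⟩
        obtain ⟨l, -, hl⟩ := hray t ht'.1 ht'.2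
        have := (hud t ht').sub ((hscd t ht').smul_const n₀)
        refine this.congr_deriv ?_
        rw [hl, inner_smul_right, mul_div_cancel_right₀ _ hnn, sub_self])
    intro t ht
    have := hz t ht
    simp only [hu0, hsc0, zero_smul, sub_zero] at this
    exact sub_eq_zero.mp this
  obtain ⟨tt, htt, hpos⟩ : ∃ tt ∈ Icc 0 T, 0 < sc tt := by
    have h1 := hscd 0 ⟨le_rfl, hTp.le⟩
    rw [hX0, hΞ0, div_self hnn, ← hasDerivWithinAt_Ioi_iff_Ici,
      hasDerivWithinAt_iff_tendsto_slope' (by simp)] at h1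
    have h2 := h1.eventually (lt_mem_nhds (show (0:ℝ) < 1 by norm_num))
    have h3 : ∀ᶠ t in 𝓝[>] (0:ℝ), t < T := nhdsWithin_le_nhds (gt_mem_nhds hTp)
    obtain ⟨t, f1, f2, f3⟩ := (h2.and (h3.and self_mem_nhdsWithin)).exists
    have f3 : (0:ℝ) < t := f3
    refine ⟨t, ⟨f3.le, f2.le⟩, ?_⟩
    rw [slope_def_field, hsc0, sub_zero, sub_zero] at f1
    exact (div_pos_iff_of_pos_right f3).mp f1
  refine ⟨sc tt, hpos, ?_⟩
  intro s hs0 hs1 x' hx' hqx ξ' hξ'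
  have hivt := intermediate_value_Icc htt.1 (hscc.mono (Icc_subset_Icc le_rfl htt.2))
  obtain ⟨t, ht, hts⟩ := hivt (show s ∈ Icc (sc 0) (sc tt) from ⟨by rw [hsc0]; exact hs0, hs1⟩)
  have ht' : t ∈ Icc 0 T := ⟨ht.1, ht.2.trans htt.2⟩
  have hXt := hXΩ t ht'.1 ht'.2
  have hxx : x' = X t := by
    apply D.injq y₀ hy0 hx' hXt
    have := huline t ht'
    rw [hts, hu] at this
    simp only
    rw [hqx, ← this]; simp only; rw [add_sub_cancel]
  obtain ⟨l, hl, hll⟩ := hray t ht'.1 ht'.2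
  have hξξ : ξ' = l⁻¹ • Ξ t := by
    apply adj_inj (D.bij x' hx' y₀ hy0)
    rw [hξ', hxx, map_smul, hll, smul_smul, inv_mul_cancel₀ hl.ne', one_smul]
  have := hm1 y₁ (Metric.mem_ball_self hr1) hy1 hF t ht'.1 (ht'.2.trans t3) hXt
  rw [hxx, hξξ, inner_smul_right]
  positivity

end Dat


section
variable {H : Type*} [NormedAddCommGroup H] [InnerProductSpace ℝ H] [FiniteDimensional ℝ H]

lemma exists_cle {L : H →L[ℝ] H} (h : Function.Bijective L) : ∃ e : H ≃L[ℝ] H, (e : H →L[ℝ] H) = L := by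
  refine ⟨(LinearEquiv.ofBijective (L : H →ₗ[ℝ] H) h).toContinuousLinearEquiv, ?_⟩
  ext v
  simp

lemma adj_bij {L : H →L[ℝ] H} (h : Function.Bijective L) :
    Function.Bijective (ContinuousLinearMap.adjoint L) :=
  ⟨adj_inj h, LinearMap.injective_iff_surjective
    (f := (ContinuousLinearMap.adjoint L : H →ₗ[ℝ] H)).mp (adj_inj h)⟩

lemma inv_der {f : H → H} {S : Set H} {L : H →L[ℝ] H} {x : H} (hS : IsOpen S) (hinj : InjOn f S)
    (hx : x ∈ S) (hf : HasStrictFDerivAt f L x) (hL : Function.Bijective L) :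
    ∃ G : H →L[ℝ] H, HasFDerivAt (Function.invFunOn f S) G (f x) ∧ (∀ v, G (L v) = v) ∧
      ∀ᶠ z in 𝓝 (f x), z ∈ f '' S := by
  obtain ⟨e, rfl⟩ := exists_cle hL
  have hmap := hf.map_nhds_eq_of_equiv
  have hgl : ∀ z ∈ S, Function.invFunOn f S (f z) = z := fun z hz => hinj.leftInvOn_invFunOn hz
  have him : ∀ᶠ z in 𝓝 (f x), z ∈ f '' S := by
    rw [← hmap]; exact image_mem_map (hS.mem_nhds hx)
  refine ⟨(e.symm : H →L[ℝ] H), ?_, fun v => by simp, him⟩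
  apply HasFDerivAt.of_local_left_inverse
  · rw [ContinuousAt, hgl x hx]
    intro O hO
    have h1 : O ∩ S ∈ 𝓝 x := inter_mem hO (hS.mem_nhds hx)
    have h2 := image_mem_map (m := f) h1
    rw [hmap] at h2
    rw [mem_map]
    filter_upwards [h2] with z hz
    obtain ⟨w, ⟨hw1, hw2⟩, rfl⟩ := hz
    rw [mem_preimage, hgl w hw2]; exact hw1
  · rw [hgl x hx]; exact hf.hasFDerivAt
  · filter_upwards [him] with z hz
    obtain ⟨w, hw, rfl⟩ := hz
    rw [hgl w hw]

/-- lifted segment -/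
lemma inv_curve {f : H → H} {S : Set H} {L : H → H →L[ℝ] H} (hS : IsOpen S) (hinj : InjOn f S)
    (hf : ∀ x ∈ S, HasStrictFDerivAt f (L x) x) (hL : ∀ x ∈ S, Function.Bijective (L x))
    (hconv : Convex ℝ (f '' S)) {x0 x1 : H} (h0 : x0 ∈ S) (h1 : x1 ∈ S) :
    ∃ X : ℝ → H, X 0 = x0 ∧ X 1 = x1 ∧ (∀ s ∈ Icc (0:ℝ) 1, X s ∈ S ∧ f (X s) = f x0 + s • (f x1 - f x0)) ∧
      ∀ s ∈ Icc (0:ℝ) 1, ∀ v, L (X s) v = f x1 - f x0 → HasDerivAt X v s := by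
  have hgl : ∀ z ∈ S, Function.invFunOn f S (f z) = z := fun z hz => hinj.leftInvOn_invFunOn hz
  set X : ℝ → H := fun s => Function.invFunOn f S (f x0 + s • (f x1 - f x0)) with hX
  have key : ∀ s ∈ Icc (0:ℝ) 1, X s ∈ S ∧ f (X s) = f x0 + s • (f x1 - f x0) := by
    intro s hs
    have : f x0 + s • (f x1 - f x0) ∈ f '' S :=
      hconv.add_smul_sub_mem ⟨x0, h0, rfl⟩ ⟨x1, h1, rfl⟩ hs
    obtain ⟨z, hz, hzz⟩ := this
    simp only [hX]
    rw [← hzz, hgl z hz]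
    exact ⟨hz, rfl⟩
  refine ⟨X, by simp [hX, hgl x0 h0], by simp [hX, hgl x1 h1], key, ?_⟩
  intro s hs v hv
  obtain ⟨k1, k2⟩ := key s hs
  obtain ⟨G, hG, hGL, -⟩ := inv_der hS hinj k1 (hf _ k1) (hL _ k1)
  have hl : HasDerivAt (fun s : ℝ => f x0 + s • (f x1 - f x0)) (f x1 - f x0) s := by
    simpa using ((hasDerivAt_id s).smul_const (f x1 - f x0)).const_add (f x0)
  rw [k2] at hG
  have := hG.comp_hasDerivAt s hl
  rw [← hv, hGL] at this
  rw [hv] at this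
  exact this

end

namespace Dat

variable {H : Type*} [NormedAddCommGroup H] [InnerProductSpace ℝ H] [FiniteDimensional ℝ H]
  {Ω Ωs : Set H} {c : H → H → ℝ} {P q : H → H → H} {A M : H → H → H →L[ℝ] H}

lemma halfspace (D : Dat Ω Ωs c P q A M) {x0 x1 y₀ y₁ ξ : H} (hx0 : x0 ∈ Ω) (hx1 : x1 ∈ Ω)
    (hy0 : y₀ ∈ Ωs) (hy1 : y₁ ∈ Ωs)
    (hξ : ContinuousLinearMap.adjoint (M x0 y₀) ξ = q x1 y₀ - q x0 y₀)
    (hle : c x0 y₁ - c x1 y₁ ≤ c x0 y₀ - c x1 y₀) : inner ℝ (P x0 y₁ - P x0 y₀) ξ ≤ 0 := by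
  by_contra hcon
  push Not at hcon
  obtain ⟨X, hX0, hX1, hXs, hXd⟩ := inv_curve (f := fun x => q x y₀)
    (L := fun x => ContinuousLinearMap.adjoint (M x y₀)) D.oΩ (D.injq y₀ hy0)
    (fun x hx => D.q' x hx y₀ hy0) (fun x hx => adj_bij (D.bij x hx y₀ hy0)) (D.convq y₀ hy0) hx0 hx1
  set d := q x1 y₀ - q x0 y₀ with hd
  have hξ0 : ξ ≠ 0 := by rintro rfl; simp at hcon
  have hd0 : d ≠ 0 := by
    intro h
    exact hξ0 (adj_inj (D.bij x0 hx0 y₀ hy0) (by rw [hξ, h, map_zero]))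
  set v : ℝ → H := fun s => ContinuousLinearMap.inverse (ContinuousLinearMap.adjoint (M (X s) y₀)) d with hv
  have hvd : ∀ s ∈ Icc (0:ℝ) 1, ContinuousLinearMap.adjoint (M (X s) y₀) (v s) = d := by
    intro s hs
    obtain ⟨e, he⟩ := exists_cle (adj_bij (D.bij _ (hXs s hs).1 y₀ hy0))
    simp only [hv]
    rw [← he, ContinuousLinearMap.inverse_equiv]
    simp
  have hXder : ∀ s ∈ Icc (0:ℝ) 1, HasDerivAt X (v s) s := fun s hs => hXd s hs _ (hvd s hs)
  have hv0 : v 0 = ξ := by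
    apply adj_inj (D.bij x0 hx0 y₀ hy0)
    rw [hξ, ← hvd 0 (by simp), hX0]
  have hvc : ∀ s ∈ Icc (0:ℝ) 1, ContinuousAt v s := by
    intro s hs
    obtain ⟨e, he⟩ := exists_cle (adj_bij (D.bij _ (hXs s hs).1 y₀ hy0))
    have h1 : ContinuousAt (fun s => M (X s) y₀) s :=
      D.cM_comp (hXder s hs).continuousAt continuousAt_const (hXs s hs).1 hy0
    have h2 : ContinuousAt (fun s => ContinuousLinearMap.adjoint (M (X s) y₀)) s :=
      (ContinuousLinearMap.adjoint (𝕜 := ℝ) (E := H) (F := H)).continuous.continuousAt.comp h1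
    have h3 : ContinuousAt (ContinuousLinearMap.inverse (R := ℝ) (M := H) (M₂ := H))
        (ContinuousLinearMap.adjoint (M (X s) y₀)) := by
      rw [← he]
      exact (contDiffAt_map_inverse (𝕜 := ℝ) (n := 1) e).continuousAt
    have h4 := ContinuousAt.comp (f := fun s => ContinuousLinearMap.adjoint (M (X s) y₀)) (x := s) h3 h2
    exact h4.clm_apply continuousAt_const
  set φ : ℝ → ℝ := fun s => inner ℝ (P (X s) y₁ - P (X s) y₀) (v s) with hφ
  have hφc : ContinuousOn φ (Icc 0 1) := by
    intro s hs
    have a1 : ContinuousAt (fun s => P (X s) y₁) s :=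
      D.cP_comp (hXder s hs).continuousAt continuousAt_const (hXs s hs).1 hy1
    have a2 : ContinuousAt (fun s => P (X s) y₀) s :=
      D.cP_comp (hXder s hs).continuousAt continuousAt_const (hXs s hs).1 hy0
    exact ((a1.sub a2).inner (𝕜 := ℝ) (hvc s hs)).continuousWithinAt
  have hφ0 : 0 < φ 0 := by
    simp only [hφ, hX0, hv0]; exact hcon
  have hall : Icc (0:ℝ) 1 ⊆ {s | 0 ≤ φ s} := by
    apply IsClosed.Icc_subset_of_forall_mem_nhdsWithin
    · rw [inter_comm]
      exact hφc.preimage_isClosed_of_isClosed isClosed_Icc isClosed_Ici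
    · exact hφ0.le
    · rintro s ⟨hs1, hs2⟩
      have hs : s ∈ Icc (0:ℝ) 1 := ⟨hs2.1, hs2.2.le⟩
      have hs1 : 0 ≤ φ s := hs1
      have hvs : v s ≠ 0 := by
        intro h
        have := hvd s hs
        rw [h, map_zero] at this
        exact hd0 this.symm
      obtain ⟨σ, hσ, hL⟩ := D.localL (hXs s hs).1 hvs hy0 hy1 hs1
      filter_upwards [self_mem_nhdsWithin, nhdsWithin_le_nhds (gt_mem_nhds (show s < s + σ by linarith)),
        nhdsWithin_le_nhds (gt_mem_nhds hs2.2)] with t k1 k2 k3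
      have k1 : s < t := k1
      have ht : t ∈ Icc (0:ℝ) 1 := ⟨hs2.1.trans k1.le, k3.le⟩
      exact hL (t - s) (by linarith) (by linarith) (X t) (hXs t ht).1 (by
        rw [(hXs t ht).2, (hXs s hs).2, hvd s hs]; module) (v t) (by rw [hvd t ht, hvd s hs])
  set g : ℝ → ℝ := fun s => c (X s) y₀ - c (X s) y₁ with hg
  have hgd : ∀ s ∈ Icc (0:ℝ) 1, HasDerivAt g (φ s) s := by
    intro s hs
    have k1 := (D.cx _ (hXs s hs).1 y₀ hy0).comp_hasDerivAt s (hXder s hs)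
    have k2 := (D.cx _ (hXs s hs).1 y₁ hy1).comp_hasDerivAt s (hXder s hs)
    refine (k1.sub k2).congr_deriv ?_
    simp [hφ, inner_sub_left]
    ring
  have hg10 : g 1 ≤ g 0 := by
    simp only [hg, hX0, hX1]; linarith
  have hmono : ∀ s ∈ Ico (0:ℝ) 1, g s ≤ g 1 := by
    intro s hs
    obtain ⟨t, ht, he⟩ := exists_hasDerivAt_eq_slope g φ hs.2
      (fun t ht => (hgd t ⟨hs.1.trans ht.1, ht.2⟩).continuousAt.continuousWithinAt)
      (fun t ht => hgd t ⟨hs.1.trans ht.1.le, ht.2.le⟩)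
    have : 0 ≤ φ t := hall ⟨hs.1.trans ht.1.le, ht.2.le⟩
    rw [he, le_div_iff₀ (by linarith [hs.2])] at this
    linarith
  have hsl := (hgd 0 (by simp)).tendsto_slope_zero_right
  have : φ 0 ≤ 0 := by
    refine le_of_tendsto hsl ?_
    filter_upwards [self_mem_nhdsWithin, nhdsWithin_le_nhds (gt_mem_nhds (show (0:ℝ) < 1 by norm_num))]
      with t k1 k2
    have k1 : 0 < t := k1
    have := hmono t ⟨k1.le, k2⟩
    rw [zero_add, smul_eq_mul]
    exact mul_nonpos_of_nonneg_of_nonpos (by positivity) (by linarith)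
  linarith

theorem main (D : Dat Ω Ωs c P q A M) {x0 x1 y₀ y₁ yθ : H} {θ : ℝ} (hx0 : x0 ∈ Ω) (hx1 : x1 ∈ Ω)
    (hy0 : y₀ ∈ Ωs) (hy1 : y₁ ∈ Ωs) (hyθ : yθ ∈ Ωs) (hθ : θ ∈ Icc (0:ℝ) 1)
    (hp : P x0 yθ = (1 - θ) • (P x0 y₀) + θ • (P x0 y₁)) :
    c x0 yθ - c x1 yθ ≤ max (c x0 y₀ - c x1 y₀) (c x0 y₁ - c x1 y₁) := by
  obtain ⟨Y, hY0, hY1, hYs, hYd⟩ := inv_curve (f := P x0) (L := fun y => M x0 y) D.oS (D.injP x0 hx0)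
    (fun y hy => D.Pyc hx0 hy) (fun y hy => D.bij x0 hx0 y hy) (D.convP x0 hx0) hy0 hy1
  have hYθ : yθ = Y θ := by
    apply D.injP x0 hx0 hyθ (hYs θ hθ).1
    rw [hp, (hYs θ hθ).2]; module
  have hw : ∀ s, ∃ w, s ∈ Icc (0:ℝ) 1 → M x0 (Y s) w = P x0 y₁ - P x0 y₀ := by
    intro s
    by_cases hs : s ∈ Icc (0:ℝ) 1
    · obtain ⟨w, hw⟩ := (D.bij x0 hx0 _ (hYs s hs).1).2 (P x0 y₁ - P x0 y₀)
      exact ⟨w, fun _ => hw⟩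
    · exact ⟨0, fun h => absurd h hs⟩
  choose w hw using hw
  set f : ℝ → ℝ := fun s => c x0 (Y s) - c x1 (Y s) with hf
  set f' : ℝ → ℝ := fun s => inner ℝ (q x1 (Y s) - q x0 (Y s)) (w s) with hf'
  have hfd : ∀ s ∈ Icc (0:ℝ) 1, HasDerivAt f (f' s) s := by
    intro s hs
    have k0 := hYd s hs (w s) (hw s hs)
    have k1 := (D.cy x0 hx0 _ (hYs s hs).1).comp_hasDerivAt s k0
    have k2 := (D.cy x1 hx1 _ (hYs s hs).1).comp_hasDerivAt s k0
    refine (k1.sub k2).congr_deriv ?_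
    simp [hf', inner_sub_left]
    ring
  set m := max (f 0) (f 1) with hm
  have hneg : ∀ s ∈ Ico (0:ℝ) 1, m < f s → f' s ≤ 0 := by
    intro s hs hms
    have hs' : s ∈ Icc (0:ℝ) 1 := ⟨hs.1, hs.2.le⟩
    have hYS := (hYs s hs').1
    obtain ⟨ξ, hξ⟩ := (adj_bij (D.bij x0 hx0 _ hYS)).2 (q x1 (Y s) - q x0 (Y s))
    have h1 : f 1 ≤ f s := (le_max_right _ _).trans hms.le
    have h2 := D.halfspace (y₁ := y₁) hx0 hx1 hYS hy1 hξ (by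
      simp only [hf, hY1] at h1; exact h1)
    rw [(hYs s hs').2, show P x0 y₁ - (P x0 y₀ + s • (P x0 y₁ - P x0 y₀)) =
      (1 - s) • (P x0 y₁ - P x0 y₀) by module, inner_smul_left] at h2
    simp only [conj_trivial] at h2
    have h3 : f' s = inner ℝ (P x0 y₁ - P x0 y₀) ξ := by
      simp only [hf']
      rw [← hξ, ContinuousLinearMap.adjoint_inner_left, hw s hs', real_inner_comm]
    rw [h3]
    by_contra hcon
    push Not at hcon
    have := mul_pos (show 0 < 1 - s by linarith [hs.2]) hcon
    linarith
  have hle : ∀ ε > (0:ℝ), f θ ≤ m + ε + ε * θ := by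
    intro ε hε
    refine image_le_of_deriv_right_lt_deriv_boundary (f := f) (f' := f') (a := 0) (b := 1)
      (B := fun s => m + ε + ε * s) (B' := fun _ => ε)
      (fun s hs => (hfd s hs).continuousAt.continuousWithinAt)
      (fun s hs => (hfd s ⟨hs.1, hs.2.le⟩).hasDerivWithinAt) ?_ ?_ ?_ hθ
    · have : f 0 ≤ m := le_max_left _ _
      change f 0 ≤ m + ε + ε * 0; linarith
    · intro s
      simpa using ((hasDerivAt_id s).const_mul ε).const_add (m + ε)
    · intro s hs hfs
      have h0 : 0 ≤ ε * s := mul_nonneg hε.le hs.1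
      have := hneg s hs (by rw [hfs]; linarith)
      linarith
  have hfin : f θ ≤ m := by
    apply le_of_forall_pos_le_add
    intro ε hε
    have := hle (ε / 2) (by positivity)
    have h1 : ε / 2 * θ ≤ ε / 2 := by
      have := hθ.2; nlinarith
    linarith
  simp only [hm, hf, hY0, hY1] at hfin
  rw [hYθ]
  exact hfin

end Dat

section Build

variable {H : Type*} [NormedAddCommGroup H] [InnerProductSpace ℝ H] [FiniteDimensional ℝ H]

/-- Minus the Riesz representative of `L ∘ J`. -/
def GJ (J : H →L[ℝ] H × H) : (H × H →L[ℝ] ℝ) →L[ℝ] H :=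
  LinearMap.toContinuousLinearMap
    { toFun := fun L => -((InnerProductSpace.toDual ℝ H).symm (L.comp J))
      map_add' := by
        intro a b
        rw [ContinuousLinearMap.add_comp, map_add, neg_add]
      map_smul' := by
        intro r a
        rw [ContinuousLinearMap.smul_comp, map_smulₛₗ]
        simp }

lemma GJ_apply (J : H →L[ℝ] H × H) (L : H × H →L[ℝ] ℝ) :
    GJ J L = -((InnerProductSpace.toDual ℝ H).symm (L.comp J)) := rfl

lemma GJ_inner (J : H →L[ℝ] H × H) (L : H × H →L[ℝ] ℝ) (v : H) :
    inner ℝ (GJ J L) v = -(L (J v)) := by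
  rw [GJ_apply, inner_neg_left, InnerProductSpace.toDual_symm_apply]
  rfl

lemma strict_post {K F G : Type*} [NormedAddCommGroup K] [NormedSpace ℝ K]
    [NormedAddCommGroup F] [NormedSpace ℝ F] [NormedAddCommGroup G] [NormedSpace ℝ G]
    (g : F →L[ℝ] G) {f : K → F} {f' : K →L[ℝ] F} {z : K} (h : HasStrictFDerivAt f f' z) :
    HasStrictFDerivAt (fun w => g (f w)) (g.comp f') z :=
  HasStrictFDerivAt.comp z g.hasStrictFDerivAt h

lemma strict_pre {K G : Type*} [NormedAddCommGroup K] [NormedSpace ℝ K]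
    [NormedAddCommGroup G] [NormedSpace ℝ G]
    {f : K × K → G} {f' : K × K →L[ℝ] G} {x y : K} (h : HasStrictFDerivAt f f' (x, y)) :
    HasStrictFDerivAt (fun w => f (w, y)) (f'.comp (ContinuousLinearMap.inl ℝ K K)) x := by
  have hi : HasStrictFDerivAt (fun x' : K => (x', y)) (ContinuousLinearMap.inl ℝ K K) x :=
    (hasStrictFDerivAt_id x).prodMk (hasStrictFDerivAt_const y x)
  exact HasStrictFDerivAt.comp (g := f) x h hi

lemma cont_post {K F G L : Type*} [NormedAddCommGroup K] [NormedSpace ℝ K]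
    [NormedAddCommGroup F] [NormedSpace ℝ F] [NormedAddCommGroup G] [NormedSpace ℝ G]
    [NormedAddCommGroup L] [NormedSpace ℝ L]
    (g : F →L[ℝ] G) (j : L →L[ℝ] K) {f : K → (K →L[ℝ] F)} {z : K} (h : ContinuousAt f z) :
    ContinuousAt (fun w => (g.comp (f w)).comp j) z :=
  (continuousAt_const.clm_comp h).clm_comp continuousAt_const

set_option maxHeartbeats 1000000 in
lemma build {Ω Ωs : Set H} {c : H → H → ℝ} (oΩ : IsOpen Ω) (oS : IsOpen Ωs)
    (hC : ∀ x ∈ Ω, ∀ y ∈ Ωs, ContDiffAt ℝ 2 (fun p : H × H => c p.1 p.2) (x, y))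
    (hbij : ∀ x ∈ Ω, ∀ y ∈ Ωs, Function.Bijective
      (fderiv ℝ (fun y' => gradient (fun x' => c x' y') x) y))
    (injP : ∀ x ∈ Ω, Set.InjOn (fun y => -gradient (fun x' => c x' y) x) Ωs)
    (injq : ∀ y ∈ Ωs, Set.InjOn (fun x => -gradient (fun y' => c x y') y) Ω)
    (convP : ∀ x ∈ Ω, Convex ℝ ((fun y => -gradient (fun x' => c x' y) x) '' Ωs))
    (convq : ∀ y ∈ Ωs, Convex ℝ ((fun x => -gradient (fun y' => c x y') y) '' Ω))
    (a3v : ∀ x₀ ∈ Ω, ∀ y₀ ∈ Ωs, ∀ y₁ ∈ Ωs, ∀ θ ∈ Ioo (0:ℝ) 1, ∀ yθ ∈ Ωs,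
      -gradient (fun x' => c x' yθ) x₀ = (1 - θ) • (-gradient (fun x' => c x' y₀) x₀)
        + θ • (-gradient (fun x' => c x' y₁) x₀) →
      ∃ η : ℝ → ℝ, Tendsto η (𝓝[>] (0:ℝ)) (𝓝 0) ∧
      ∀ x ∈ Ω, max (c x₀ y₀ - c x y₀) (c x₀ y₁ - c x y₁) ≥
        c x₀ yθ - c x yθ - η ‖x - x₀‖ * ‖x - x₀‖ ^ 2) :
    ∃ A M : H → H → H →L[ℝ] H,
      Dat Ω Ωs c (fun x y => -gradient (fun x' => c x' y) x)
        (fun x y => -gradient (fun y' => c x y') y) A M := by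
  set C : H × H → ℝ := fun p => c p.1 p.2 with hCdef
  have hd : ∀ x ∈ Ω, ∀ y ∈ Ωs, HasFDerivAt C (fderiv ℝ C (x, y)) (x, y) := fun x hx y hy =>
    ((hC x hx y hy).differentiableAt (by norm_num)).hasFDerivAt
  have hx' : ∀ x ∈ Ω, ∀ y ∈ Ωs, HasFDerivAt (fun x' => c x' y)
      ((fderiv ℝ C (x, y)).comp (ContinuousLinearMap.inl ℝ H H)) x := by
    intro x hx y hy
    have hi : HasFDerivAt (fun x' : H => (x', y)) (ContinuousLinearMap.inl ℝ H H) x :=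
      hasFDerivAt_prodMk_left x y
    have hh := HasFDerivAt.comp x (hd x hx y hy) hi
    exact hh
  have hy' : ∀ x ∈ Ω, ∀ y ∈ Ωs, HasFDerivAt (fun y' => c x y')
      ((fderiv ℝ C (x, y)).comp (ContinuousLinearMap.inr ℝ H H)) y := by
    intro x hx y hy
    have hi : HasFDerivAt (fun y' : H => (x, y')) (ContinuousLinearMap.inr ℝ H H) y :=
      hasFDerivAt_prodMk_right x y
    have hh := HasFDerivAt.comp y (hd x hx y hy) hi
    exact hh
  have hPe : ∀ x ∈ Ω, ∀ y ∈ Ωs, -gradient (fun x' => c x' y) x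
      = GJ (ContinuousLinearMap.inl ℝ H H) (fderiv ℝ C (x, y)) := by
    intro x hx y hy
    rw [GJ_apply, gradient, (hx' x hx y hy).fderiv]
  have hqe : ∀ x ∈ Ω, ∀ y ∈ Ωs, -gradient (fun y' => c x y') y
      = GJ (ContinuousLinearMap.inr ℝ H H) (fderiv ℝ C (x, y)) := by
    intro x hx y hy
    rw [GJ_apply, gradient, (hy' x hx y hy).fderiv]
  have hD1 : ∀ x ∈ Ω, ∀ y ∈ Ωs, ContDiffAt ℝ 1 (fderiv ℝ C) (x, y) := fun x hx y hy =>
    (hC x hx y hy).fderiv_right (m := 1) (by norm_num)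
  have hD2 : ∀ x ∈ Ω, ∀ y ∈ Ωs, ContinuousAt (fderiv ℝ (fderiv ℝ C)) (x, y) := fun x hx y hy =>
    ((hD1 x hx y hy).fderiv_right (m := 0) (by norm_num)).continuousAt
  have hS : ∀ x ∈ Ω, ∀ y ∈ Ωs, HasStrictFDerivAt (fderiv ℝ C) (fderiv ℝ (fderiv ℝ C) (x, y)) (x, y) :=
    fun x hx y hy => (hD1 x hx y hy).hasStrictFDerivAt (by norm_num)
  set A : H → H → H →L[ℝ] H := fun x y => ((GJ (ContinuousLinearMap.inl ℝ H H)).comp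
    (fderiv ℝ (fderiv ℝ C) (x, y))).comp (ContinuousLinearMap.inl ℝ H H) with hA
  set M : H → H → H →L[ℝ] H := fun x y => ((GJ (ContinuousLinearMap.inl ℝ H H)).comp
    (fderiv ℝ (fderiv ℝ C) (x, y))).comp (ContinuousLinearMap.inr ℝ H H) with hM
  have hP' : ∀ x ∈ Ω, ∀ y ∈ Ωs,
      HasStrictFDerivAt (fun z : H × H => -gradient (fun x' => c x' z.2) z.1)
        ((A x y).coprod (M x y)) (x, y) := by
    intro x hx y hy
    have h1 := strict_post (K := H × H) (F := H × H →L[ℝ] ℝ) (G := H) (f := fderiv ℝ C)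
      (f' := fderiv ℝ (fderiv ℝ C) (x, y)) (z := (x, y))
      (GJ (ContinuousLinearMap.inl ℝ H H)) (hS x hx y hy)
    have h2 : (A x y).coprod (M x y) = (GJ (ContinuousLinearMap.inl ℝ H H)).comp
        (fderiv ℝ (fderiv ℝ C) (x, y)) := by
      rw [hA, hM]
      exact ContinuousLinearMap.coprod_comp_inl_inr _
    rw [h2]
    refine h1.congr_of_eventuallyEq ?_
    filter_upwards [(oΩ.prod oS).mem_nhds (Set.mk_mem_prod hx hy)] with z hz
    exact (hPe z.1 hz.1 z.2 hz.2).symm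
  refine ⟨A, M, ⟨oΩ, oS, ?_, ?_, hP', ?_, ?_, ?_, ?_, injP, injq, convP, convq, a3v⟩⟩
  · intro x hx y hy
    have e : -(innerSL ℝ (-gradient (fun x' => c x' y) x))
        = (fderiv ℝ C (x, y)).comp (ContinuousLinearMap.inl ℝ H H) := by
      ext v
      rw [hPe x hx y hy, neg_apply, innerSL_apply_apply, GJ_inner, neg_neg]
      rfl
    beta_reduce
    rw [e]; exact hx' x hx y hy
  · intro x hx y hy
    have e : -(innerSL ℝ (-gradient (fun y' => c x y') y))
        = (fderiv ℝ C (x, y)).comp (ContinuousLinearMap.inr ℝ H H) := by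
      ext v
      rw [hqe x hx y hy, neg_apply, innerSL_apply_apply, GJ_inner, neg_neg]
      rfl
    beta_reduce
    rw [e]; exact hy' x hx y hy
  · intro x hx y hy
    have h1 := strict_pre (strict_post (K := H × H) (F := H × H →L[ℝ] ℝ) (G := H) (f := fderiv ℝ C)
      (f' := fderiv ℝ (fderiv ℝ C) (x, y)) (z := (x, y))
      (GJ (ContinuousLinearMap.inr ℝ H H)) (hS x hx y hy))
    have h2 : ContinuousLinearMap.adjoint (M x y) = ((GJ (ContinuousLinearMap.inr ℝ H H)).comp
        (fderiv ℝ (fderiv ℝ C) (x, y))).comp (ContinuousLinearMap.inl ℝ H H) := by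
      symm
      rw [ContinuousLinearMap.eq_adjoint_iff]
      intro u v
      have hsym : IsSymmSndFDerivAt ℝ C (x, y) := (hC x hx y hy).isSymmSndFDerivAt (by simp)
      rw [real_inner_comm]
      simp only [hM, ContinuousLinearMap.comp_apply]
      rw [real_inner_comm, GJ_inner, real_inner_comm, GJ_inner]
      rw [hsym.eq]
    rw [h2]
    refine h1.congr_of_eventuallyEq ?_
    filter_upwards [oΩ.mem_nhds hx] with z hz
    exact (hqe z hz y hy).symm
  · intro x hx y hy
    have hh := cont_post (K := H × H) (F := H × H →L[ℝ] ℝ) (G := H) (L := H)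
      (f := fderiv ℝ (fderiv ℝ C)) (z := (x, y))
      (GJ (ContinuousLinearMap.inl ℝ H H)) (ContinuousLinearMap.inl ℝ H H) (hD2 x hx y hy)
    exact hh
  · intro x hx y hy
    have hh := cont_post (K := H × H) (F := H × H →L[ℝ] ℝ) (G := H) (L := H)
      (f := fderiv ℝ (fderiv ℝ C)) (z := (x, y))
      (GJ (ContinuousLinearMap.inl ℝ H H)) (ContinuousLinearMap.inr ℝ H H) (hD2 x hx y hy)
    exact hh
  · intro x hx y hy
    have h1 : HasFDerivAt (fun y' => -gradient (fun x' => c x' y') x) (M x y) y := by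
      have h2 : HasFDerivAt (fun y' : H => (x, y')) (ContinuousLinearMap.inr ℝ H H) y :=
        hasFDerivAt_prodMk_right x y
      have h3 := HasFDerivAt.comp y (hP' x hx y hy).hasFDerivAt h2
      rwa [ContinuousLinearMap.coprod_comp_inr] at h3
    have h4 : HasFDerivAt (fun y' => gradient (fun x' => c x' y') x) (-M x y) y := by
      simpa only [Pi.neg_def, neg_neg] using h1.neg
    have h5 := hbij x hx y hy
    rw [h4.fderiv] at h5
    have h6 : (M x y : H → H) = (fun v => -v) ∘ (-M x y : H →L[ℝ] H) := by
      funext v; simp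
    rw [h6]
    exact (Equiv.neg H).bijective.comp h5

end Build

/-- under A1, A2, mutual c-convexity and A3v, condition A3v holds without the
error term. -/
theorem a3v_without_error_term {n : ℕ} (hn : 1 ≤ n)
    (Ω Ωs : Set (E n)) (c : E n → E n → ℝ)
    (hΩ : NiceDomain Ω) (hΩs : NiceDomain Ωs)
    (hc : CostC2 Ω Ωs c) (h1 : CondA1 Ω Ωs c) (h2 : CondA2 Ω Ωs c)
    (hmc : MutuallyCConvex Ω Ωs c) (h3 : CondA3v Ω Ωs c) :
    ∀ x₀ ∈ Ω, ∀ x ∈ Ω, ∀ y₀ ∈ Ωs, ∀ y₁ ∈ Ωs, ∀ θ ∈ Icc (0:ℝ) 1, ∀ yθ ∈ Ωs,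
      -Dx c x₀ yθ = (1 - θ) • (-Dx c x₀ y₀) + θ • (-Dx c x₀ y₁) →
      max (c x₀ y₀ - c x y₀) (c x₀ y₁ - c x y₁) ≥ c x₀ yθ - c x yθ := by
  obtain ⟨U, hU, hsub, hCU⟩ := hc
  obtain ⟨A, M, D⟩ := build (c := c) hΩ.2.1 hΩs.2.1
    (fun x hx y hy => hCU.contDiffAt (hU.mem_nhds (hsub (Set.mk_mem_prod hx hy))))
    h2 h1.1 h1.2 hmc.1 hmc.2 h3
  intro x₀ hx₀ x hx y₀ hy₀ y₁ hy₁ θ hθ yθ hyθ hp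
  exact D.main hx₀ hx hy₀ hy₁ hyθ hθ hp
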